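/- Let p ≥ 3 and let D2{p} denote the dual of the generalised cube 2^{{p}}, where {p} is the p-gon; D2{p} is a regular polyhedron of type {p, 4} whose faces (2-faces) are p-gons. The regular hypertope Γ(H(D2{p})) obtained by the halving operation is a self-dual regular polyhedron of type {p, p} with 2^{p−1} vertices, 2^{p−2}·p edges and 2^{p−1} faces; in particular its Euler characteristic is 2^{p−2}(4−p), so it is a map on a surface of genus 2^{p−3}(p−4) + 1. -/

import Mathlib

set_option autoImplicit false

noncomputable section

/-! ### C-groups -/

/-- A family of involutions satisfying the intersection condition
(the family is a *C-group* for the group it generates). -/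
def IsCGroup {G : Type*} [Group G] {I : Type*} (ρ : I → G) : Prop :=
  (∀ i, orderOf (ρ i) = 2) ∧
    ∀ J K : Set I,
      Subgroup.closure (ρ '' J) ⊓ Subgroup.closure (ρ '' K) =
        Subgroup.closure (ρ '' (J ∩ K))

/-! ### Incidence systems -/

/-- The data of an incidence system over a type set `I`. -/
structure IncidenceSystem (I : Type*) where
  X : Type*
  t : X → I
  inc : X → X → Prop

namespace IncidenceSystem

variable {I : Type*} (Γ : IncidenceSystem I)

/-- The axioms of an incidence system: incidence is reflexive, symmetric and
two incident elements of the same type are equal. -/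
def IsSystem : Prop :=
  (∀ x, Γ.inc x x) ∧ (∀ x y, Γ.inc x y → Γ.inc y x) ∧
    ∀ x y, Γ.inc x y → Γ.t x = Γ.t y → x = y

/-- A flag: a set of pairwise incident elements. -/
def IsFlag (F : Set Γ.X) : Prop := ∀ x ∈ F, ∀ y ∈ F, Γ.inc x y

/-- A chamber: a flag whose type set is all of `I`. -/
def IsChamber (C : Set Γ.X) : Prop := Γ.IsFlag C ∧ Γ.t '' C = Set.univ

/-- An incidence geometry: every flag is contained in a chamber. -/
def IsGeometry : Prop :=
  Γ.IsSystem ∧ ∀ F : Set Γ.X, Γ.IsFlag F → ∃ C : Set Γ.X, Γ.IsChamber C ∧ F ⊆ C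

/-- The set of elements of the residue of the flag `F`. -/
def residueSet (F : Set Γ.X) : Set Γ.X := {x | x ∉ F ∧ ∀ y ∈ F, Γ.inc x y}

/-- Thin: every residue of rank one has exactly two elements. -/
def IsThin : Prop :=
  ∀ F : Set Γ.X, Γ.IsFlag F → (Set.univ \ Γ.t '' F).ncard = 1 →
    (Γ.residueSet F).ncard = 2

/-- Connectivity of the incidence graph restricted to a set `S`. -/
def ConnOn (S : Set Γ.X) : Prop :=
  ∀ x ∈ S, ∀ y ∈ S,
    Relation.ReflTransGen (fun a b => a ∈ S ∧ b ∈ S ∧ Γ.inc a b) x y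

/-- Connectivity of the incidence graph. -/
def IsConnected : Prop := Γ.ConnOn Set.univ

/-- Residual connectedness: connected and every residue of rank at least two
is connected. -/
def IsResiduallyConnected : Prop :=
  Γ.IsConnected ∧
    ∀ F : Set Γ.X, Γ.IsFlag F → 2 ≤ (Set.univ \ Γ.t '' F).ncard →
      Γ.ConnOn (Γ.residueSet F)

/-- A hypertope: a thin residually connected incidence geometry. -/
def IsHypertope : Prop := Γ.IsGeometry ∧ Γ.IsThin ∧ Γ.IsResiduallyConnected

/-- The group of type-preserving automorphisms. -/
def typeAut : Subgroup (Equiv.Perm Γ.X) where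
  carrier := {α | (∀ x, Γ.t (α x) = Γ.t x) ∧
    ∀ x y, Γ.inc (α x) (α y) ↔ Γ.inc x y}
  one_mem' := ⟨fun _ => rfl, fun _ _ => Iff.rfl⟩
  mul_mem' := by
    rintro a b ⟨ha1, ha2⟩ ⟨hb1, hb2⟩
    refine ⟨fun x => ?_, fun x y => ?_⟩
    · simp only [Equiv.Perm.mul_apply]; rw [ha1, hb1]
    · simp only [Equiv.Perm.mul_apply]; rw [ha2, hb2]
  inv_mem' := by
    rintro a ⟨ha1, ha2⟩
    refine ⟨fun x => ?_, fun x y => ?_⟩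
    · simpa using (ha1 (a⁻¹ x)).symm
    · simpa using (ha2 (a⁻¹ x) (a⁻¹ y)).symm

/-- Transitivity of the type-preserving automorphism group on chambers. -/
def ChamberTransitive : Prop :=
  ∀ C D : Set Γ.X, Γ.IsChamber C → Γ.IsChamber D →
    ∃ α ∈ Γ.typeAut, ⇑α '' C = D

/-- A regular hypertope: a chamber-transitive hypertope. -/
def IsRegularHypertope : Prop := Γ.IsHypertope ∧ Γ.ChamberTransitive

/-- Flag-transitivity: for each type set, the type-preserving automorphism group
is transitive on flags of that type. -/
def FlagTransitive : Prop :=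
  ∀ F G : Set Γ.X, Γ.IsFlag F → Γ.IsFlag G → Γ.t '' F = Γ.t '' G →
    ∃ α ∈ Γ.typeAut, ⇑α '' F = G

/-- `C'` is the chamber `i`-adjacent to the chamber `C`:  it is a chamber
differing from `C` exactly in its element of type `i`. -/
def IAdjacentChamber (C C' : Set Γ.X) (i : I) : Prop :=
  Γ.IsChamber C' ∧ C' ≠ C ∧ ∀ x ∈ C, Γ.t x ≠ i → x ∈ C'

/-- The stabiliser of a flag in the type-preserving automorphism group. -/
def flagStab (F : Set Γ.X) : Subgroup ↥Γ.typeAut where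
  carrier := {α | ∀ x ∈ F, (↑α : Equiv.Perm Γ.X) x = x}
  one_mem' := by intro x hx; simp
  mul_mem' := by
    intro a b ha hb x hx
    simp only [Subgroup.coe_mul, Equiv.Perm.mul_apply]
    rw [hb x hx, ha x hx]
  inv_mem' := by
    intro a ha x hx
    have h2 := congrArg (⇑(↑a : Equiv.Perm Γ.X)⁻¹) (ha x hx)
    simpa using h2.symm

end IncidenceSystem
/-! ### Coset incidence systems -/

/-- The right coset `H g`. -/
def rCoset {G : Type*} [Group G] (H : Subgroup G) (g : G) : Set G :=
  {x | x * g⁻¹ ∈ H}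

/-- The elements of the coset incidence system: right cosets of the `Gi`,
marked by their type. -/
abbrev cosetX {G : Type*} [Group G] {I : Type*} (Gi : I → Subgroup G) : Type _ :=
  Σ i : I, {s : Set G // ∃ g : G, s = rCoset (Gi i) g}

/-- The coset incidence system `Γ(G; (G_i)_{i ∈ I})`: the `i`-elements are the
right cosets of `G_i`, and two cosets are incident iff they meet. -/
def cosetSystem {G : Type*} [Group G] {I : Type*} (Gi : I → Subgroup G) :
    IncidenceSystem I where
  X := cosetX Gi
  t := fun x => x.1
  inc := fun x y => (x.2.1 ∩ y.2.1).Nonempty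

/-- Right multiplication by `g` on the cosets. -/
def cosetMul {G : Type*} [Group G] {I : Type*} (Gi : I → Subgroup G) (g : G) :
    cosetX Gi → cosetX Gi :=
  fun x => ⟨x.1, ⟨(· * g) '' x.2.1, by
    obtain ⟨s, g₀, hg₀⟩ := x.2
    refine ⟨g₀ * g, ?_⟩
    subst hg₀
    ext y
    simp only [Set.mem_image, rCoset, Set.mem_setOf_eq, mul_inv_rev]
    constructor
    · rintro ⟨z, hz, rfl⟩
      simpa [mul_assoc] using hz
    · intro hy
      exact ⟨y * g⁻¹, by simpa [mul_assoc] using hy, by simp⟩⟩⟩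
/-! ### Abstract polytopes -/

/-- A flag of a partially ordered set: a maximal chain. -/
def IsMaxFlag (P : Type*) [PartialOrder P] (F : Set P) : Prop :=
  IsMaxChain (· ≤ ·) F

/-- Strong flag-connectivity: any two flags `F`, `G` are joined by a sequence of
flags, each containing `F ∩ G`, in which consecutive flags differ in exactly
one face. -/
def StronglyFlagConnected (P : Type*) [PartialOrder P] : Prop :=
  ∀ F G : Set P, IsMaxFlag P F → IsMaxFlag P G →
    Relation.ReflTransGen
      (fun A B => IsMaxFlag P A ∧ IsMaxFlag P B ∧ F ∩ G ⊆ A ∧ F ∩ G ⊆ B ∧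
        (A \ B).ncard = 1 ∧ (B \ A).ncard = 1) F G

/-- An abstract polytope of rank `n`: a bounded poset, graded by the rank
function `rk` ranging from `-1` (the least face) to `n` (the greatest face),
each flag containing exactly one face of each rank (hence `n + 2` faces),
satisfying the diamond condition and strong flag-connectivity. -/
def IsPolytope (P : Type*) [PartialOrder P] (rk : P → ℤ) (n : ℕ) : Prop :=
  (∃ b : P, IsBot b ∧ rk b = -1) ∧
  (∃ tp : P, IsTop tp ∧ rk tp = n) ∧
  StrictMono rk ∧
  (∀ F : Set P, IsMaxFlag P F → ∀ k : ℤ, -1 ≤ k → k ≤ (n : ℤ) → ∃ x ∈ F, rk x = k) ∧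
  (∀ x z : P, x < z → rk z = rk x + 2 → {y : P | x < y ∧ y < z}.ncard = 2) ∧
  StronglyFlagConnected P

/-- Non-degenerate: every section of rank 2 is a `p`-gon with `p ≥ 3`,
i.e. has at least three faces of each intermediate rank. -/
def NonDegenerate (P : Type*) [PartialOrder P] (rk : P → ℤ) : Prop :=
  ∀ F G : P, F < G → rk G = rk F + 3 →
    ∃ H₁ H₂ H₃ : P,
      (F < H₁ ∧ H₁ < G ∧ rk H₁ = rk F + 1) ∧
      (F < H₂ ∧ H₂ < G ∧ rk H₂ = rk F + 1) ∧
      (F < H₃ ∧ H₃ < G ∧ rk H₃ = rk F + 1) ∧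
      H₁ ≠ H₂ ∧ H₁ ≠ H₃ ∧ H₂ ≠ H₃

/-- The group of order automorphisms of a poset (the automorphism group of an
abstract polytope). -/
def orderAut (P : Type*) [PartialOrder P] : Subgroup (Equiv.Perm P) where
  carrier := {α | ∀ x y : P, α x ≤ α y ↔ x ≤ y}
  one_mem' := fun _ _ => Iff.rfl
  mul_mem' := by
    intro a b ha hb x y
    simp only [Equiv.Perm.mul_apply]
    rw [ha, hb]
  inv_mem' := by
    intro a ha x y
    simpa using (ha (a⁻¹ x) (a⁻¹ y)).symm

/-- A regular polytope: the automorphism group is transitive on flags. -/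
def IsRegularPolytope (P : Type*) [PartialOrder P] : Prop :=
  ∀ F G : Set P, IsMaxFlag P F → IsMaxFlag P G →
    ∃ α ∈ orderAut P, ⇑α '' F = G

/-- `Φ` is a base flag and `ϱ` the corresponding family of distinguished
generators: `ϱ i` maps `Φ` to the flag `Φ^i` differing from `Φ` exactly in
its face of rank `i`. -/
def IsDistinguishedGens (P : Type*) [PartialOrder P] (rk : P → ℤ) (n : ℕ)
    (Φ : Set P) (ϱ : Fin n → ↥(orderAut P)) : Prop :=
  IsMaxFlag P Φ ∧
    ∀ i : Fin n,
      ⇑(ϱ i).1 '' Φ ≠ Φ ∧ ∀ x ∈ Φ, rk x ≠ (i : ℤ) → x ∈ ⇑(ϱ i).1 '' Φ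

/-- The incidence system associated with an abstract polytope: the elements are
the proper faces (the faces of ranks `0, …, n-1`), the type of a face is its
rank and incidence is comparability. -/
def polytopeSystem (P : Type*) [PartialOrder P] (rk : P → ℤ) (n : ℕ) :
    IncidenceSystem (Fin n) where
  X := {x : P // 0 ≤ rk x ∧ rk x < (n : ℤ)}
  t := fun x => ⟨(rk x.1).toNat, by
    have h1 := x.2.1; have h2 := x.2.2; omega⟩
  inc := fun x y => x.1 ≤ y.1 ∨ y.1 ≤ x.1

/-! ### The halving operation -/

/-- The halving generators: `ρ i = ϱ i` for `i ≤ n - 2` and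
`ρ (n-1) = ϱ (n-1) * ϱ (n-2) * ϱ (n-1)`. -/
def halvingGens {G : Type*} [Group G] (n : ℕ) (ϱ : Fin n → G) : Fin n → G :=
  fun i =>
    if (i : ℕ) = n - 1 then
      ϱ i * ϱ (⟨n - 2, by have := i.isLt; omega⟩ : Fin n) * ϱ i
    else ϱ i

/-- The lift of a generating family into the subgroup it generates. -/
def liftGens {G : Type*} [Group G] {I : Type*} (ρ : I → G) :
    I → ↥(Subgroup.closure (Set.range ρ)) :=
  fun i => ⟨ρ i, Subgroup.subset_closure (Set.mem_range_self i)⟩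

/-- The subgroups `H_i = ⟨ρ_j : j ≠ i⟩` of the halving group `H(P)`,
where `ρ` is the family of halving generators obtained from `ϱ`. -/
def halvingCosetFamily {G : Type*} [Group G] (n : ℕ) (ϱ : Fin n → G) :
    Fin n → Subgroup ↥(Subgroup.closure (Set.range (halvingGens n ϱ))) :=
  fun i => Subgroup.closure (liftGens (halvingGens n ϱ) '' {j | j ≠ i})

/-- The coset incidence system `Γ(H(P); (H_i))` of the halving group. -/
def halvingCosetSystem {G : Type*} [Group G] (n : ℕ) (ϱ : Fin n → G) :
    IncidenceSystem (Fin n) :=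
  cosetSystem (halvingCosetFamily n ϱ)
/-! ### Generalised cubes -/

/-- The vertex set of a polytope: the faces of rank `0`. -/
abbrev polyVertices (K : Type*) (rk : K → ℤ) : Type _ := {v : K // rk v = 0}

/-- The face `F(x)` of the generalised cube `2^K`:
`F(x) = {y : y_v = x_v whenever the vertex v is not incident to F}`. -/
def cubeFace (K : Type*) [PartialOrder K] (rk : K → ℤ) (F : K)
    (x : polyVertices K rk → Bool) : Set (polyVertices K rk → Bool) :=
  {y | ∀ v : polyVertices K rk, ¬ v.1 ≤ F → y v = x v}

/-- Danzer's generalised cube `2^K`: the improper least face `∅` together with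
the sets `F(x)` for `F` a face of `K` (for `F` the least face of `K` this
gives the singletons `{x}`, the vertices of `2^K`; the faces of rank `i ≥ 1`
are the `F(x)` with `rk F = i - 1 ≥ 0`), ordered by inclusion. -/
abbrev genCube (K : Type*) [PartialOrder K] (rk : K → ℤ) : Type _ :=
  {S : Set (polyVertices K rk → Bool) //
    S = ∅ ∨ ∃ (F : K) (x : polyVertices K rk → Bool), S = cubeFace K rk F x}

/-- The rank function of the dual of a polytope of rank `n`. -/
def dualRk {P : Type*} (rk : P → ℤ) (n : ℕ) : Pᵒᵈ → ℤ :=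
  fun x => (n : ℤ) - 1 - rk (OrderDual.ofDual x)

/-- `D2 K rk n`, for `K` a polytope of rank `n`, is the polytope
`D2K = (2^{K*})*`, the dual of the generalised cube over the dual of `K`. -/
abbrev D2 (K : Type*) [PartialOrder K] (rkK : K → ℤ) (n : ℕ) : Type _ :=
  (genCube Kᵒᵈ (dualRk rkK n))ᵒᵈ

/-! ### Flags and automorphisms of polytopes -/

theorem IsMaxFlag.mem_of_comparable {P : Type*} [PartialOrder P] {F : Set P}
    (hF : IsMaxFlag P F) {x : P} (h : ∀ y ∈ F, x ≤ y ∨ y ≤ x) : x ∈ F := by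
  have h1 : IsChain (· ≤ ·) (insert x F) := hF.1.insert fun b hb _ => h b hb
  rw [hF.2 h1 (Set.subset_insert x F)]
  exact Set.mem_insert x F

theorem exists_isMaxFlag_of_isChain {P : Type*} [PartialOrder P] {C : Set P}
    (hC : IsChain (· ≤ ·) C) : ∃ F, IsMaxFlag P F ∧ C ⊆ F :=
  hC.exists_maxChain

theorem exists_isMaxFlag_mem {P : Type*} [PartialOrder P] (x : P) :
    ∃ F, IsMaxFlag P F ∧ x ∈ F := by
  obtain ⟨F, hF, h⟩ := exists_isMaxFlag_of_isChain (IsChain.singleton (r := (· ≤ ·)) (a := x))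
  exact ⟨F, hF, h rfl⟩

theorem IsMaxFlag.image_orderAut {P : Type*} [PartialOrder P] {F : Set P}
    (hF : IsMaxFlag P F) {α : Equiv.Perm P} (hα : α ∈ orderAut P) :
    IsMaxFlag P (α '' F) :=
  IsMaxChain.image (⟨α, fun {x y} => hα x y⟩ : ((· ≤ ·) : P → P → Prop) ≃r ((· ≤ ·) : P → P → Prop))
    hF

theorem orderAut_strictMono {P : Type*} [PartialOrder P] {α : Equiv.Perm P}
    (hα : α ∈ orderAut P) : StrictMono α := by
  intro x y h
  rw [lt_iff_le_not_ge] at h ⊢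
  rwa [hα, hα]

theorem isMaxFlag_orderDual {P : Type*} [PartialOrder P] {F : Set P} :
    IsMaxFlag Pᵒᵈ F ↔ IsMaxFlag P F :=
  ⟨fun h => IsMaxChain.symm h, fun h => IsMaxChain.symm h⟩

namespace IsPolytope

variable {P : Type*} [PartialOrder P] {rk : P → ℤ} {n : ℕ}

theorem rk_strictMono (h : IsPolytope P rk n) : StrictMono rk := h.2.2.1

theorem neg_one_le (h : IsPolytope P rk n) (x : P) : -1 ≤ rk x := by
  obtain ⟨b, hb, hb'⟩ := h.1
  rw [← hb']
  exact h.rk_strictMono.monotone (hb x)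

theorem rk_le (h : IsPolytope P rk n) (x : P) : rk x ≤ n := by
  obtain ⟨b, hb, hb'⟩ := h.2.1
  rw [← hb']
  exact h.rk_strictMono.monotone (hb x)

theorem isBot_of_rk (h : IsPolytope P rk n) {x : P} (hx : rk x = -1) : IsBot x := by
  obtain ⟨b, hb, hb'⟩ := h.1
  rcases (hb x).eq_or_lt with h1 | h1
  · exact h1 ▸ hb
  · have := h.rk_strictMono h1
    omega

theorem isTop_of_rk (h : IsPolytope P rk n) {x : P} (hx : rk x = n) : IsTop x := by
  obtain ⟨b, hb, hb'⟩ := h.2.1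
  rcases (hb x).eq_or_lt with h1 | h1
  · exact h1 ▸ hb
  · have := h.rk_strictMono h1
    omega

theorem exists_mem (h : IsPolytope P rk n) {F : Set P} (hF : IsMaxFlag P F) {k : ℤ}
    (h1 : -1 ≤ k) (h2 : k ≤ n) : ∃ x ∈ F, rk x = k := h.2.2.2.1 F hF k h1 h2

theorem le_of_rk_le (h : IsPolytope P rk n) {F : Set P} (hF : IsMaxFlag P F) {x y : P}
    (hx : x ∈ F) (hy : y ∈ F) (hxy : rk x ≤ rk y) : x ≤ y := by
  rcases hF.1.total hx hy with h1 | h1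
  · exact h1
  · rcases h1.eq_or_lt with h2 | h2
    · exact h2.ge
    · have := h.rk_strictMono h2
      omega

theorem eq_of_rk_eq (h : IsPolytope P rk n) {F : Set P} (hF : IsMaxFlag P F) {x y : P}
    (hx : x ∈ F) (hy : y ∈ F) (hxy : rk x = rk y) : x = y :=
  le_antisymm (h.le_of_rk_le hF hx hy hxy.le) (h.le_of_rk_le hF hy hx hxy.ge)

theorem lt_of_rk_lt (h : IsPolytope P rk n) {F : Set P} (hF : IsMaxFlag P F) {x y : P}
    (hx : x ∈ F) (hy : y ∈ F) (hxy : rk x < rk y) : x < y :=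
  lt_of_le_of_ne (h.le_of_rk_le hF hx hy hxy.le) (by rintro rfl; omega)

theorem flag_connected (h : IsPolytope P rk n) {F G : Set P} (hF : IsMaxFlag P F)
    (hG : IsMaxFlag P G) : Relation.ReflTransGen
      (fun A B => IsMaxFlag P A ∧ IsMaxFlag P B ∧ (A \ B).ncard = 1) F G :=
  Relation.ReflTransGen.mono (fun _ _ hAB => ⟨hAB.1, hAB.2.1, hAB.2.2.2.2.1⟩)
    _ _ (h.2.2.2.2.2 F G hF hG)

theorem orderDual (h : IsPolytope P rk n) : IsPolytope Pᵒᵈ (dualRk rk n) n := by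
  obtain ⟨⟨b, hb, hb'⟩, ⟨t, ht, ht'⟩, hm, hf, hd, hc⟩ := h
  refine ⟨⟨OrderDual.toDual t, ht, ?_⟩, ⟨OrderDual.toDual b, hb, ?_⟩, ?_, ?_, ?_, ?_⟩
  · simp [dualRk, ht']
  · simp [dualRk, hb']
  · intro x y hxy
    have := hm (OrderDual.ofDual_lt_ofDual.2 hxy)
    simp only [dualRk]
    omega
  · intro F hF k h1 h2
    obtain ⟨x, hx, hk⟩ := hf F (isMaxFlag_orderDual.1 hF) (n - 1 - k) (by omega) (by omega)
    exact ⟨OrderDual.toDual x, hx, by simp [dualRk, hk]⟩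
  · intro x z hxz hr
    have h1 := hd (OrderDual.ofDual z) (OrderDual.ofDual x) hxz (by simp only [dualRk] at hr; omega)
    rw [← h1]
    congr 1
    ext y
    exact And.comm
  · intro F G hF hG
    have := hc F G (isMaxFlag_orderDual.1 hF) (isMaxFlag_orderDual.1 hG)
    refine Relation.ReflTransGen.mono (fun A B => ?_) _ _ this
    rintro ⟨h1, h2, h3⟩
    exact ⟨isMaxFlag_orderDual.2 h1, isMaxFlag_orderDual.2 h2, h3⟩

/-- The rank function of a polytope is the least strictly monotone function with
values at least `-1`. -/
theorem rk_le_of_strictMono (h : IsPolytope P rk n) {f : P → ℤ} (hf : StrictMono f)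
    (hf' : ∀ x, -1 ≤ f x) (x : P) : rk x ≤ f x := by
  suffices H : ∀ (k : ℕ) (x : P), rk x = (k : ℤ) - 1 → (k : ℤ) - 1 ≤ f x by
    have h1 := h.neg_one_le x
    have h2 := H (rk x + 1).toNat x (by omega)
    omega
  intro k
  induction k with
  | zero => intro x _; simpa using hf' x
  | succ k ih =>
    intro x hx
    obtain ⟨F, hF, hxF⟩ := exists_isMaxFlag_mem x
    obtain ⟨y, hy, hky⟩ := h.exists_mem hF (k := (k : ℤ) - 1) (by omega)
      (by have := h.rk_le x; push_cast at hx; omega)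
    have h1 := ih y hky
    have h2 := hf (h.lt_of_rk_lt hF hy hxF (by push_cast at hx; omega))
    push_cast
    omega

theorem rk_unique (h : IsPolytope P rk n) {rk' : P → ℤ} {n' : ℕ} (h' : IsPolytope P rk' n') :
    rk = rk' :=
  funext fun x => le_antisymm (h.rk_le_of_strictMono h'.rk_strictMono h'.neg_one_le x)
    (h'.rk_le_of_strictMono h.rk_strictMono h.neg_one_le x)

theorem rk_orderAut (h : IsPolytope P rk n) {α : Equiv.Perm P} (hα : α ∈ orderAut P) (x : P) :
    rk (α x) = rk x := by
  have key : ∀ β ∈ orderAut P, ∀ y, rk y ≤ rk (β y) := fun β hβ =>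
    h.rk_le_of_strictMono (f := fun y => rk (β y))
      (h.rk_strictMono.comp (orderAut_strictMono hβ)) (fun y => h.neg_one_le _)
  refine le_antisymm ?_ (key α hα x)
  simpa using key α⁻¹ (inv_mem hα) (α x)

/-- An automorphism preserving a flag fixes all its faces. -/
theorem apply_eq_of_image_eq (h : IsPolytope P rk n) {α : Equiv.Perm P} (hα : α ∈ orderAut P)
    {F : Set P} (hF : IsMaxFlag P F) (hαF : α '' F = F) {x : P} (hx : x ∈ F) : α x = x :=
  h.eq_of_rk_eq hF (hαF ▸ Set.mem_image_of_mem α hx) hx (h.rk_orderAut hα x)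

/-- A flag has at most one `i`-adjacent flag. -/
theorem adjacent_unique (h : IsPolytope P rk n) {F F₁ F₂ : Set P} {i : ℤ} (h0 : 0 ≤ i)
    (hi : i < n) (hF : IsMaxFlag P F) (hF₁ : IsMaxFlag P F₁) (hF₂ : IsMaxFlag P F₂)
    (hne₁ : F₁ ≠ F) (hne₂ : F₂ ≠ F) (hs₁ : ∀ x ∈ F, rk x ≠ i → x ∈ F₁)
    (hs₂ : ∀ x ∈ F, rk x ≠ i → x ∈ F₂) : F₁ = F₂ := by
  obtain ⟨u, hu, hur⟩ := h.exists_mem hF (k := i - 1) (by omega) (by omega)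
  obtain ⟨z, hz, hzr⟩ := h.exists_mem hF (k := i + 1) (by omega) (by omega)
  obtain ⟨x, hx, hxr⟩ := h.exists_mem hF (k := i) (by omega) (by omega)
  have key : ∀ G, IsMaxFlag P G → G ≠ F → (∀ x ∈ F, rk x ≠ i → x ∈ G) →
      ∃ y ∈ G, rk y = i ∧ u < y ∧ y < z ∧ y ≠ x := by
    intro G hG hne hs
    obtain ⟨y, hy, hyr⟩ := h.exists_mem hG (k := i) (by omega) (by omega)
    refine ⟨y, hy, hyr, h.lt_of_rk_lt hG (hs u hu (by omega)) hy (by omega),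
      h.lt_of_rk_lt hG hy (hs z hz (by omega)) (by omega), ?_⟩
    rintro rfl
    refine hne (hF.2 hG.1 fun w hw => ?_).symm
    by_cases hwr : rk w = i
    · rw [h.eq_of_rk_eq hF hw hx (by omega)]; exact hy
    · exact hs w hw hwr
  obtain ⟨y₁, hy₁, hr₁, hu₁, hz₁, hn₁⟩ := key F₁ hF₁ hne₁ hs₁
  obtain ⟨y₂, hy₂, hr₂, hu₂, hz₂, hn₂⟩ := key F₂ hF₂ hne₂ hs₂
  have hux : u < x := h.lt_of_rk_lt hF hu hx (by omega)
  have hxz : x < z := h.lt_of_rk_lt hF hx hz (by omega)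
  have hcard := h.2.2.2.2.1 u z (hux.trans hxz) (by omega)
  have hy : y₁ = y₂ := by
    obtain ⟨a, b, -, hab⟩ := Set.ncard_eq_two.1 hcard
    have m₁ : y₁ ∈ ({a, b} : Set P) := hab ▸ ⟨hu₁, hz₁⟩
    have m₂ : y₂ ∈ ({a, b} : Set P) := hab ▸ ⟨hu₂, hz₂⟩
    have m₃ : x ∈ ({a, b} : Set P) := hab ▸ ⟨hux, hxz⟩
    simp only [Set.mem_insert_iff, Set.mem_singleton_iff] at m₁ m₂ m₃
    grind
  refine hF₁.2 hF₂.1 fun w hw => ?_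
  by_cases hwr : rk w = i
  · rw [h.eq_of_rk_eq hF₁ hw hy₁ (by omega), hy]; exact hy₂
  · obtain ⟨w', hw', hr'⟩ := h.exists_mem hF (k := rk w) (h.neg_one_le w) (h.rk_le w)
    rw [h.eq_of_rk_eq hF₁ hw (hs₁ w' hw' (by omega)) hr'.symm]
    exact hs₂ w' hw' (by omega)

/-- Flags differing in one face are `i`-adjacent for some rank `i`. -/
theorem exists_rank_of_ncard_diff (h : IsPolytope P rk n) {A B : Set P}
    (hB : IsMaxFlag P B) (hAB : (A \ B).ncard = 1) :
    ∃ i : ℤ, 0 ≤ i ∧ i < n ∧ B ≠ A ∧ ∀ x ∈ A, rk x ≠ i → x ∈ B := by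
  obtain ⟨x, hx⟩ := Set.ncard_eq_one.1 hAB
  have hxm : x ∈ A \ B := hx ▸ rfl
  refine ⟨rk x, ?_, ?_, fun h => hxm.2 (h ▸ hxm.1), fun y hy hyr => ?_⟩
  · rcases (h.neg_one_le x).eq_or_lt with h1 | h1
    · exact absurd (hB.mem_of_comparable fun y _ => Or.inl (h.isBot_of_rk h1.symm y)) hxm.2
    · omega
  · rcases (h.rk_le x).eq_or_lt with h1 | h1
    · exact absurd (hB.mem_of_comparable fun y _ => Or.inr (h.isTop_of_rk h1 y)) hxm.2
    · omega
  · by_contra hyB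
    have : y ∈ A \ B := ⟨hy, hyB⟩
    rw [hx] at this
    exact hyr (this ▸ rfl)

/-- An automorphism preserving a flag is trivial. -/
theorem eq_one_of_image_eq (h : IsPolytope P rk n) {α : Equiv.Perm P} (hα : α ∈ orderAut P)
    {F : Set P} (hF : IsMaxFlag P F) (hαF : α '' F = F) : α = 1 := by
  have key : ∀ G, IsMaxFlag P G → α '' G = G := by
    intro G hG
    have hc := h.flag_connected hF hG
    induction hc with
    | refl => exact hαF
    | @tail A B _ hAB ih =>
      obtain ⟨hA, hB, h1⟩ := hAB
      have ihA := ih hA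
      obtain ⟨i, h0, hi, hne, hs⟩ := h.exists_rank_of_ncard_diff hB h1
      refine h.adjacent_unique h0 hi hA (hB.image_orderAut hα) hB ?_ hne ?_ hs
      · intro hBA
        rw [← ihA] at hBA
        exact hne (α.injective.image_injective hBA)
      · intro x hx hr
        rw [← h.apply_eq_of_image_eq hα hA ihA hx]
        exact Set.mem_image_of_mem α (hs x hx hr)
  ext x
  obtain ⟨G, hG, hxG⟩ := exists_isMaxFlag_mem x
  exact h.apply_eq_of_image_eq hα hG (key G hG) hxG

theorem distinguishedGens_unique (h : IsPolytope P rk n) {Φ : Set P}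
    {ϱ ϱ' : Fin n → ↥(orderAut P)} (h₁ : IsDistinguishedGens P rk n Φ ϱ)
    (h₂ : IsDistinguishedGens P rk n Φ ϱ') : ϱ = ϱ' := by
  funext i
  have h3 : ⇑(ϱ i).1 '' Φ = ⇑(ϱ' i).1 '' Φ :=
    h.adjacent_unique (i := (i : ℤ)) (by omega) (by omega) h₁.1 (h₁.1.image_orderAut (ϱ i).2)
      (h₁.1.image_orderAut (ϱ' i).2) (h₁.2 i).1 (h₂.2 i).1 (h₁.2 i).2 (h₂.2 i).2
  have h4 := h.eq_one_of_image_eq (α := (ϱ' i)⁻¹.1 * (ϱ i).1) (((ϱ' i)⁻¹ * ϱ i).2) h₁.1 (by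
    rw [Equiv.Perm.coe_mul, Set.image_comp, h3, ← Set.image_comp]
    simp)
  have h5 : (ϱ' i)⁻¹ * ϱ i = 1 := Subtype.ext h4
  exact (inv_mul_eq_one.1 h5).symm

/-- A polytope in which every flag has distinguished generators is regular. -/
theorem isRegular_of_distinguishedGens (h : IsPolytope P rk n)
    (hg : ∀ Φ, IsMaxFlag P Φ → ∃ ϱ, IsDistinguishedGens P rk n Φ ϱ) : IsRegularPolytope P := by
  intro F G hF hG
  have hc := h.flag_connected hF hG
  induction hc with
  | refl => exact ⟨1, one_mem _, by simp⟩
  | @tail A B _ hAB ih =>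
    obtain ⟨hA, hB, h1⟩ := hAB
    obtain ⟨α, hα, hαA⟩ := ih hA
    obtain ⟨i, h0, hi, hne, hs⟩ := h.exists_rank_of_ncard_diff hB h1
    obtain ⟨ϱ, -, hϱ⟩ := hg A hA
    obtain ⟨hϱ1, hϱ2⟩ := hϱ ⟨i.toNat, by omega⟩
    refine ⟨(ϱ ⟨i.toNat, by omega⟩).1 * α, mul_mem (ϱ _).2 hα, ?_⟩
    rw [Equiv.Perm.coe_mul, Set.image_comp, hαA]
    refine h.adjacent_unique h0 hi hA (hA.image_orderAut (ϱ _).2) hB hϱ1 hne (fun x hx hr => ?_) hs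
    exact hϱ2 x hx (by simpa [h0] using hr)

end IsPolytope

/-! ### Generalised cubes are polytopes -/

/-- Every face is determined by the vertices incident to it. -/
def VertexDescribable (L : Type*) [PartialOrder L] (rk : L → ℤ) : Prop :=
  ∀ F G : L, (∀ v : polyVertices L rk, v.1 ≤ F → v.1 ≤ G) → F ≤ G

namespace genCube

variable {L : Type*} [PartialOrder L] {rk : L → ℤ} {n : ℕ}

/-- The face `F(x)`, as an element of the generalised cube. -/
def mk (F : L) (x : polyVertices L rk → Bool) : genCube L rk :=
  ⟨cubeFace L rk F x, Or.inr ⟨F, x, rfl⟩⟩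

/-- The improper least face. -/
def empty : genCube L rk := ⟨∅, Or.inl rfl⟩

theorem mem_cubeFace {F : L} {x y : polyVertices L rk → Bool} :
    y ∈ cubeFace L rk F x ↔ ∀ v : polyVertices L rk, ¬ v.1 ≤ F → y v = x v := Iff.rfl

theorem self_mem_cubeFace (F : L) (x : polyVertices L rk → Bool) : x ∈ cubeFace L rk F x :=
  fun _ _ => rfl

theorem cubeFace_eq_of_mem {F : L} {x y : polyVertices L rk → Bool}
    (h : y ∈ cubeFace L rk F x) : cubeFace L rk F y = cubeFace L rk F x := by
  ext z
  exact ⟨fun hz v hv => (hz v hv).trans (h v hv), fun hz v hv => (hz v hv).trans (h v hv).symm⟩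

theorem mk_ne_empty (F : L) (x : polyVertices L rk → Bool) : mk F x ≠ empty := by
  intro h
  have h1 : cubeFace L rk F x = ∅ := congrArg Subtype.val h
  exact (Set.eq_empty_iff_forall_notMem.1 h1) x (self_mem_cubeFace F x)

theorem mk_eq_of_mem {S : genCube L rk} {x : polyVertices L rk → Bool} (h : x ∈ S.1) :
    ∃ F, S = mk F x := by
  obtain ⟨s, rfl | ⟨F, z, rfl⟩⟩ := S
  · exact h.elim
  · exact ⟨F, Subtype.ext (cubeFace_eq_of_mem h).symm⟩

theorem eq_empty_or_eq_mk (S : genCube L rk) : S = empty ∨ ∃ F x, S = mk F x := by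
  obtain ⟨s, rfl | ⟨F, z, rfl⟩⟩ := S
  · exact Or.inl rfl
  · exact Or.inr ⟨F, z, rfl⟩

theorem isBot_empty : IsBot (empty : genCube L rk) := fun S => Set.empty_subset S.1

theorem empty_lt_mk (F : L) (x : polyVertices L rk → Bool) : empty < mk F x :=
  lt_of_le_of_ne (isBot_empty _) (mk_ne_empty F x).symm


theorem mk_le_mk (hD : VertexDescribable L rk) {F G : L} {x y : polyVertices L rk → Bool} :
    mk F x ≤ mk G y ↔ F ≤ G ∧ x ∈ cubeFace L rk G y := by
  classical
  constructor
  · intro h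
    have h' : cubeFace L rk F x ⊆ cubeFace L rk G y := h
    refine ⟨hD F G fun v hv => ?_, h' (self_mem_cubeFace F x)⟩
    by_contra hvG
    have h1 : Function.update x v (!x v) ∈ cubeFace L rk F x := by
      intro w hw
      rw [Function.update_of_ne]
      rintro rfl
      exact hw hv
    have h2 := h' h1 v hvG
    have h3 := h' (self_mem_cubeFace F x) v hvG
    rw [Function.update_self, ← h3] at h2
    cases hx : x v <;> simp [hx] at h2
  · rintro ⟨h1, h2⟩ z hz v hv
    exact (hz v fun hvF => hv (hvF.trans h1)).trans (h2 v hv)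

theorem mk_le_mk_self (hD : VertexDescribable L rk) {F G : L} {x : polyVertices L rk → Bool} :
    mk F x ≤ mk G x ↔ F ≤ G := by
  rw [mk_le_mk hD, and_iff_left (self_mem_cubeFace G x)]

theorem mk_eq_mk (hD : VertexDescribable L rk) {F G : L} {x y : polyVertices L rk → Bool} :
    mk F x = mk G y ↔ F = G ∧ x ∈ cubeFace L rk G y := by
  constructor
  · intro h
    have h1 := (mk_le_mk hD).1 h.le
    have h2 := (mk_le_mk hD).1 h.ge
    exact ⟨le_antisymm h1.1 h2.1, h1.2⟩
  · rintro ⟨rfl, h⟩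
    exact Subtype.ext (cubeFace_eq_of_mem h)

theorem mk_lt_mk (hD : VertexDescribable L rk) {F G : L} {x y : polyVertices L rk → Bool} :
    mk F x < mk G y ↔ F < G ∧ x ∈ cubeFace L rk G y := by
  rw [lt_iff_le_and_ne, lt_iff_le_and_ne, mk_le_mk hD, Ne, mk_eq_mk hD]
  tauto

theorem mk_lt_mk_self (hD : VertexDescribable L rk) {F G : L} {x : polyVertices L rk → Bool} :
    mk F x < mk G x ↔ F < G := by
  rw [mk_lt_mk hD, and_iff_left (self_mem_cubeFace G x)]

theorem mk_injective (hD : VertexDescribable L rk) (x : polyVertices L rk → Bool) :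
    Function.Injective fun F : L => mk F x :=
  fun _ _ h => ((mk_eq_mk hD).1 h).1

open Classical in
/-- The rank function of the generalised cube. -/
def rank (S : genCube L rk) : ℤ :=
  if h : ∃ (F : L) (x : polyVertices L rk → Bool), S = mk F x then rk h.choose + 1 else -1

theorem rank_empty : rank (empty : genCube L rk) = -1 := by
  rw [rank, dif_neg]
  rintro ⟨F, x, h⟩
  exact mk_ne_empty F x h.symm

theorem rank_mk (hD : VertexDescribable L rk) (F : L) (x : polyVertices L rk → Bool) :
    rank (mk F x) = rk F + 1 := by
  have h : ∃ (G : L) (y : polyVertices L rk → Bool), mk F x = mk G y := ⟨F, x, rfl⟩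
  obtain ⟨y, hy⟩ := h.choose_spec
  rw [rank, dif_pos h, ← ((mk_eq_mk hD).1 hy).1]

/-- The flag of the generalised cube determined by a vertex and a flag. -/
def flag (x : polyVertices L rk → Bool) (Φ : Set L) : Set (genCube L rk) :=
  insert empty ((fun F => mk F x) '' Φ)

theorem mk_mem_flag (hD : VertexDescribable L rk) {F : L} {x : polyVertices L rk → Bool}
    {Φ : Set L} : mk F x ∈ flag x Φ ↔ F ∈ Φ := by
  rw [flag, Set.mem_insert_iff, or_iff_right (mk_ne_empty F x)]
  exact (mk_injective hD x).mem_set_image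

theorem isChain_flag (hD : VertexDescribable L rk) {x : polyVertices L rk → Bool} {Φ : Set L}
    (hΦ : IsChain (· ≤ ·) Φ) : IsChain (· ≤ ·) (flag x Φ) := by
  refine IsChain.insert ?_ fun S _ _ => Or.inl (isBot_empty S)
  rintro _ ⟨F, hF, rfl⟩ _ ⟨G, hG, rfl⟩ -
  simp only [mk_le_mk_self hD]
  exact hΦ.total hF hG

theorem mem_cubeFace_of_isBot (hL : IsPolytope L rk n) {b : L} (hb : rk b = -1)
    {x y : polyVertices L rk → Bool} : y ∈ cubeFace L rk b x ↔ y = x := by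
  constructor
  · intro h
    funext v
    refine h v fun hv => ?_
    have := hL.rk_strictMono.monotone hv
    have := v.2
    omega
  · rintro rfl
    exact self_mem_cubeFace _ _

theorem isMaxFlag_flag (hL : IsPolytope L rk n) (hD : VertexDescribable L rk)
    {x : polyVertices L rk → Bool} {Φ : Set L} (hΦ : IsMaxFlag L Φ) :
    IsMaxFlag (genCube L rk) (flag x Φ) := by
  refine ⟨isChain_flag hD hΦ.1, fun C hC hsub => subset_antisymm hsub fun S hS => ?_⟩
  rcases eq_empty_or_eq_mk S with rfl | ⟨G, z, rfl⟩
  · exact Set.mem_insert _ _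
  obtain ⟨b, hb, hb'⟩ := hL.exists_mem hΦ (k := -1) le_rfl (by omega)
  have hbx : mk b x ∈ C := hsub ((mk_mem_flag hD).2 hb)
  have hx : x ∈ cubeFace L rk G z := by
    rcases hC.total hbx hS with h | h
    · exact ((mk_le_mk hD).1 h).2
    · have h1 := ((mk_le_mk hD).1 h).2
      rw [mem_cubeFace_of_isBot hL hb'] at h1
      exact h1 ▸ self_mem_cubeFace G z
  have hGx : mk G z = mk G x := Subtype.ext (cubeFace_eq_of_mem hx).symm
  rw [hGx] at hS ⊢
  rw [mk_mem_flag hD]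
  refine hΦ.mem_of_comparable fun F hF => ?_
  have := hC.total hS (hsub ((mk_mem_flag hD).2 hF))
  simpa only [mk_le_mk_self hD] using this

theorem exists_eq_flag [Finite L] (hD : VertexDescribable L rk) {C : Set (genCube L rk)}
    (hC : IsMaxFlag (genCube L rk) C) :
    ∃ (x : polyVertices L rk → Bool) (Φ : Set L), IsMaxFlag L Φ ∧ C = flag x Φ := by
  have hemp : empty ∈ C := hC.mem_of_comparable fun S _ => Or.inl (isBot_empty S)
  obtain ⟨x, hx⟩ : ∃ x : polyVertices L rk → Bool, ∀ S ∈ C, S ≠ empty → x ∈ S.1 := by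
    by_cases hne : (C \ {empty}).Nonempty
    · obtain ⟨m, hm⟩ := (Set.toFinite (C \ {empty})).exists_minimal hne
      rcases eq_empty_or_eq_mk m with rfl | ⟨F, x, rfl⟩
      · exact absurd rfl hm.1.2
      refine ⟨x, fun S hS hS' => ?_⟩
      have hle : mk F x ≤ S := by
        rcases hC.1.total hm.1.1 hS with h | h
        · exact h
        · exact hm.2 ⟨hS, hS'⟩ h
      exact hle (self_mem_cubeFace F x)
    · refine ⟨fun _ => false, fun S hS hS' => absurd ⟨S, hS, hS'⟩ hne⟩
  have hCeq : C = flag x {F | mk F x ∈ C} := by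
    ext S
    constructor
    · intro hS
      by_cases hS' : S = empty
      · exact hS' ▸ Set.mem_insert _ _
      · obtain ⟨F, rfl⟩ := mk_eq_of_mem (hx S hS hS')
        exact (mk_mem_flag hD).2 hS
    · rintro (rfl | ⟨F, hF, rfl⟩)
      · exact hemp
      · exact hF
  refine ⟨x, {F | mk F x ∈ C}, ⟨?_, fun Ψ hΨ hsub => subset_antisymm hsub fun F hF => ?_⟩, hCeq⟩
  · intro F hF G hG _
    have := hC.1.total hF hG
    simpa only [mk_le_mk_self hD] using this
  · have h1 : C ⊆ flag x Ψ := by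
      rw [hCeq]
      exact Set.insert_subset_insert (Set.image_mono hsub)
    have h2 := hC.2 (isChain_flag hD hΨ) h1
    change mk F x ∈ C
    rw [h2]
    exact (mk_mem_flag hD).2 hF

theorem rank_strictMono (hL : IsPolytope L rk n) (hD : VertexDescribable L rk) :
    StrictMono (rank : genCube L rk → ℤ) := by
  intro S T hST
  rcases eq_empty_or_eq_mk T with rfl | ⟨G, y, rfl⟩
  · exact absurd (isBot_empty S) hST.not_ge
  rw [rank_mk hD]
  have := hL.neg_one_le G
  rcases eq_empty_or_eq_mk S with rfl | ⟨F, x, rfl⟩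
  · rw [rank_empty]; omega
  · rw [rank_mk hD]
    have := hL.rk_strictMono ((mk_lt_mk hD).1 hST).1
    omega

theorem cubeFace_vertex [DecidableEq (polyVertices L rk)] (hL : IsPolytope L rk n)
    (v : polyVertices L rk) (x : polyVertices L rk → Bool) :
    cubeFace L rk v.1 x = {x, Function.update x v (!x v)} := by
  ext y
  simp only [Set.mem_insert_iff, Set.mem_singleton_iff]
  constructor
  · intro hy
    by_cases hv : y v = x v
    · left
      funext w
      by_cases hw : w.1 ≤ v.1
      · rcases hw.eq_or_lt with h | h
        · rw [Subtype.ext h, hv]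
        · have := hL.rk_strictMono h
          rw [w.2, v.2] at this
          omega
      · exact hy w hw
    · right
      funext w
      by_cases hw : w = v
      · subst hw
        rw [Function.update_self]
        cases h : y w <;> cases h' : x w <;> simp_all
      · rw [Function.update_of_ne hw]
        refine hy w fun h => ?_
        rcases h.eq_or_lt with h | h
        · exact hw (Subtype.ext h)
        · have := hL.rk_strictMono h
          rw [w.2, v.2] at this
          omega
  · rintro (rfl | rfl)
    · exact self_mem_cubeFace _ _
    · intro w hw
      rw [Function.update_of_ne]
      rintro rfl
      exact hw le_rfl

theorem diamond (hL : IsPolytope L rk n) (hD : VertexDescribable L rk) (S T : genCube L rk)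
    (hST : S < T) (hr : rank T = rank S + 2) : {U | S < U ∧ U < T}.ncard = 2 := by
  classical
  rcases eq_empty_or_eq_mk T with rfl | ⟨G, y, rfl⟩
  · exact absurd (isBot_empty S) hST.not_ge
  rcases eq_empty_or_eq_mk S with rfl | ⟨F, x, rfl⟩
  · rw [rank_empty, rank_mk hD] at hr
    obtain ⟨v, rfl⟩ : ∃ v : polyVertices L rk, G = v.1 := ⟨⟨G, by omega⟩, rfl⟩
    obtain ⟨b, hb, hb'⟩ := hL.1
    have : {U | empty < U ∧ U < mk v.1 y} = {mk b y, mk b (Function.update y v (!y v))} := by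
      have hbv : b < v.1 := lt_of_le_of_ne (hb _) (by intro h; have := v.2; rw [← h] at this; omega)
      ext U
      simp only [Set.mem_ofPred_eq, Set.mem_insert_iff, Set.mem_singleton_iff]
      constructor
      · rintro ⟨h1, h2⟩
        rcases eq_empty_or_eq_mk U with rfl | ⟨H, z, rfl⟩
        · exact absurd rfl h1.ne
        rw [mk_lt_mk hD, cubeFace_vertex hL] at h2
        have hH : H = b := by
          have := hL.rk_strictMono h2.1
          have := hL.neg_one_le H
          have := v.2
          exact le_antisymm (hL.isBot_of_rk (by omega) b) (hb H)
        subst hH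
        rcases h2.2 with h3 | h3
        · left; rw [h3]
        · right; rw [Set.mem_singleton_iff.1 h3]
      · rintro (rfl | rfl)
        · exact ⟨empty_lt_mk _ _, (mk_lt_mk hD).2 ⟨hbv, self_mem_cubeFace _ _⟩⟩
        · refine ⟨empty_lt_mk _ _, (mk_lt_mk hD).2 ⟨hbv, ?_⟩⟩
          rw [cubeFace_vertex hL]
          exact Or.inr rfl
    rw [this, Set.ncard_pair]
    rw [Ne, mk_eq_mk hD, mem_cubeFace_of_isBot hL hb']
    rintro ⟨-, h⟩
    have := congrFun h v
    rw [Function.update_self] at this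
    cases h' : y v <;> simp [h'] at this
  · obtain ⟨hFG, hx⟩ := (mk_lt_mk hD).1 hST
    have hGx : mk G y = mk G x := Subtype.ext (cubeFace_eq_of_mem hx).symm
    rw [hGx] at hr ⊢
    rw [rank_mk hD, rank_mk hD] at hr
    rw [← hL.2.2.2.2.1 F G hFG (by omega), ← Set.ncard_image_of_injective _ (mk_injective hD x)]
    congr 1
    ext U
    simp only [Set.mem_ofPred_eq, Set.mem_image]
    constructor
    · rintro ⟨h1, h2⟩
      obtain ⟨H, rfl⟩ := mk_eq_of_mem (h1.le (self_mem_cubeFace F x))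
      exact ⟨H, ⟨(mk_lt_mk_self hD).1 h1, (mk_lt_mk_self hD).1 h2⟩, rfl⟩
    · rintro ⟨H, ⟨h1, h2⟩, rfl⟩
      exact ⟨(mk_lt_mk_self hD).2 h1, (mk_lt_mk_self hD).2 h2⟩

/-- The adjacency of flags containing a prescribed set of faces. -/
def Adj (S : Set (genCube L rk)) (A B : Set (genCube L rk)) : Prop :=
  IsMaxFlag _ A ∧ IsMaxFlag _ B ∧ S ⊆ A ∧ S ⊆ B ∧ (A \ B).ncard = 1 ∧ (B \ A).ncard = 1

theorem flag_diff_flag (hD : VertexDescribable L rk) (x : polyVertices L rk → Bool)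
    (Φ Ψ : Set L) : flag x Φ \ flag x Ψ = (fun F => mk F x) '' (Φ \ Ψ) := by
  ext S
  constructor
  · rintro ⟨rfl | ⟨F, hF, rfl⟩, h2⟩
    · exact absurd (Set.mem_insert _ _) h2
    · exact ⟨F, ⟨hF, fun h => h2 ((mk_mem_flag hD).2 h)⟩, rfl⟩
  · rintro ⟨F, ⟨h1, h2⟩, rfl⟩
    exact ⟨(mk_mem_flag hD).2 h1, fun h => h2 ((mk_mem_flag hD).1 h)⟩

theorem connected_of_eq_vertex (hL : IsPolytope L rk n) (hD : VertexDescribable L rk)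
    {S : Set (genCube L rk)} (x : polyVertices L rk → Bool) {Φ Ψ : Set L} (hΦ : IsMaxFlag L Φ)
    (hΨ : IsMaxFlag L Ψ) (h1 : S ⊆ flag x Φ) (h2 : S ⊆ flag x Ψ) :
    Relation.ReflTransGen (Adj S) (flag x Φ) (flag x Ψ) := by
  refine Relation.ReflTransGen.lift (fun Φ => flag x Φ) (fun A B => ?_) _ _ (hL.2.2.2.2.2 Φ Ψ hΦ hΨ)
  rintro ⟨hA, hB, hsA, hsB, hcA, hcB⟩
  have key : ∀ A, Φ ∩ Ψ ⊆ A → S ⊆ flag x A := by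
    intro A hA T hT
    rcases h1 hT with rfl | ⟨F, hF, rfl⟩
    · exact Set.mem_insert _ _
    · exact (mk_mem_flag hD).2 (hA ⟨hF, (mk_mem_flag hD).1 (h2 hT)⟩)
  refine ⟨isMaxFlag_flag hL hD hA, isMaxFlag_flag hL hD hB, key A hsA, key B hsB, ?_, ?_⟩
  · rw [flag_diff_flag hD, Set.ncard_image_of_injective _ (mk_injective hD x), hcA]
  · rw [flag_diff_flag hD, Set.ncard_image_of_injective _ (mk_injective hD x), hcB]

theorem flag_diff_flag_of_vertex (hL : IsPolytope L rk n) (hD : VertexDescribable L rk)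
    {x y : polyVertices L rk → Bool} {v : polyVertices L rk} (hxy : x ∈ cubeFace L rk v.1 y)
    (hne : x ≠ y) {Φ : Set L} (hΦ : IsMaxFlag L Φ) (hv : v.1 ∈ Φ) :
    (flag x Φ \ flag y Φ).ncard = 1 := by
  obtain ⟨b, hb, hb'⟩ := hL.exists_mem hΦ (k := -1) le_rfl (by omega)
  rw [Set.ncard_eq_one]
  refine ⟨mk b x, ?_⟩
  ext S
  rw [Set.mem_singleton_iff]
  constructor
  · rintro ⟨rfl | ⟨F, hF, rfl⟩, h2⟩
    · exact absurd (Set.mem_insert _ _) h2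
    · by_cases hFv : v.1 ≤ F
      · refine absurd ?_ h2
        have : mk F x = mk F y :=
          Subtype.ext (cubeFace_eq_of_mem fun w hw => hxy w fun h => hw (h.trans hFv))
        change mk F x ∈ _
        rw [this, mk_mem_flag hD]
        exact hF
      · have h3 := hΦ.1.total hv hF
        have h4 : F < v.1 := lt_of_le_not_ge (h3.resolve_left hFv) hFv
        have h5 := hL.rk_strictMono h4
        have h6 := hL.neg_one_le F
        have h7 := v.2
        rw [hL.eq_of_rk_eq hΦ hF hb (by omega)]
  · rintro rfl
    refine ⟨(mk_mem_flag hD).2 hb, ?_⟩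
    rintro (h | ⟨F, hF, h⟩)
    · exact mk_ne_empty _ _ h
    · obtain ⟨rfl, h'⟩ := (mk_eq_mk hD).1 h
      exact hne ((mem_cubeFace_of_isBot hL hb').1 h').symm

theorem connected_of_card [Finite L] (hL : IsPolytope L rk n) (hD : VertexDescribable L rk)
    {S : Set (genCube L rk)} (N : ℕ) : ∀ (x y : polyVertices L rk → Bool) (Φ Ψ : Set L),
      {v | x v ≠ y v}.ncard = N → IsMaxFlag L Φ → IsMaxFlag L Ψ → S ⊆ flag x Φ → S ⊆ flag y Ψ →
      Relation.ReflTransGen (Adj S) (flag x Φ) (flag y Ψ) := by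
  classical
  induction N with
  | zero =>
    intro x y Φ Ψ hN hΦ hΨ h1 h2
    have hxy : x = y := by
      rw [Set.ncard_eq_zero] at hN
      funext v
      by_contra h
      exact (Set.eq_empty_iff_forall_notMem.1 hN) v h
    subst hxy
    exact connected_of_eq_vertex hL hD x hΦ hΨ h1 h2
  | succ N ih =>
    intro x y Φ Ψ hN hΦ hΨ h1 h2
    obtain ⟨v, hv⟩ : {v | x v ≠ y v}.Nonempty := by
      rw [← Set.ncard_pos]; omega
    have hv' : x v ≠ y v := hv
    set x' := Function.update x v (y v) with hx'
    have hxx' : x ∈ cubeFace L rk v.1 x' := by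
      intro w hw
      rw [hx', Function.update_of_ne]
      rintro rfl
      exact hw le_rfl
    have hx'x : x' ∈ cubeFace L rk v.1 x := fun w hw => (hxx' w hw).symm
    have hne : x ≠ x' := fun h => hv' (by rw [h, hx', Function.update_self])
    have hmem : ∀ F, mk F x ∈ S → F ∈ Φ ∧ v.1 ≤ F := by
      intro F hF
      refine ⟨(mk_mem_flag hD).1 (h1 hF), ?_⟩
      rcases h2 hF with h | ⟨G, _, h⟩
      · exact absurd h (mk_ne_empty F x)
      · obtain ⟨rfl, h'⟩ := (mk_eq_mk hD).1 h
        by_contra hvF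
        exact hv' (h' v hvF).symm
    have hchain : IsChain (· ≤ ·) (insert v.1 {F | mk F x ∈ S}) := by
      refine IsChain.insert (hΦ.1.mono fun F hF => (hmem F hF).1) fun F hF _ => ?_
      exact Or.inl (hmem F hF).2
    obtain ⟨Φ', hΦ', hsub⟩ := exists_isMaxFlag_of_isChain hchain
    have hvΦ' : v.1 ∈ Φ' := hsub (Set.mem_insert _ _)
    have hS1 : S ⊆ flag x Φ' := by
      intro T hT
      rcases h1 hT with rfl | ⟨F, hF, rfl⟩
      · exact Set.mem_insert _ _
      · exact (mk_mem_flag hD).2 (hsub (Set.mem_insert_of_mem _ hT))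
    have hS2 : S ⊆ flag x' Φ' := by
      intro T hT
      rcases h1 hT with rfl | ⟨F, hF, rfl⟩
      · exact Set.mem_insert _ _
      · have : mk F x = mk F x' := Subtype.ext (cubeFace_eq_of_mem fun w hw =>
          hxx' w fun h => hw (h.trans (hmem F hT).2))
        change mk F x ∈ _
        rw [this, mk_mem_flag hD]
        exact hsub (Set.mem_insert_of_mem _ hT)
    refine (connected_of_eq_vertex hL hD x hΦ hΦ' h1 hS1).trans
      (Relation.ReflTransGen.head ?_ (ih x' y Φ' Ψ ?_ hΦ' hΨ hS2 h2))
    · exact ⟨isMaxFlag_flag hL hD hΦ', isMaxFlag_flag hL hD hΦ', hS1, hS2,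
        flag_diff_flag_of_vertex hL hD hxx' hne hΦ' hvΦ',
        flag_diff_flag_of_vertex hL hD hx'x hne.symm hΦ' hvΦ'⟩
    · have : {w | x' w ≠ y w} = {w | x w ≠ y w} \ {v} := by
        ext w
        simp only [Set.mem_ofPred_eq, Set.mem_sdiff, Set.mem_singleton_iff]
        by_cases hw : w = v
        · subst hw
          simp [hx']
        · simp [hx', hw]
      rw [this, Set.ncard_sdiff_singleton_of_mem hv, hN]
      rfl

theorem isPolytope [Finite L] (hL : IsPolytope L rk n) (hD : VertexDescribable L rk) :
    IsPolytope (genCube L rk) rank (n + 1) := by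
  refine ⟨⟨empty, isBot_empty, rank_empty⟩, ?_, rank_strictMono hL hD, ?_, diamond hL hD, ?_⟩
  · obtain ⟨t, ht, ht'⟩ := hL.2.1
    refine ⟨mk t fun _ => false, fun S z _ v hv => absurd (ht _) hv, ?_⟩
    rw [rank_mk hD, ht']
    push_cast
    rfl
  · intro C hC k h1 h2
    obtain ⟨x, Φ, hΦ, rfl⟩ := exists_eq_flag hD hC
    rcases h1.eq_or_lt with rfl | h1
    · exact ⟨empty, Set.mem_insert _ _, rank_empty⟩
    · push_cast at h2
      obtain ⟨F, hF, hFk⟩ := hL.exists_mem hΦ (k := k - 1) (by omega) (by omega)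
      exact ⟨mk F x, (mk_mem_flag hD).2 hF, by rw [rank_mk hD]; omega⟩
  · intro A B hA hB
    obtain ⟨x, Φ, hΦ, rfl⟩ := exists_eq_flag hD hA
    obtain ⟨y, Ψ, hΨ, rfl⟩ := exists_eq_flag hD hB
    exact connected_of_card hL hD _ x y Φ Ψ rfl hΦ hΨ Set.inter_subset_left Set.inter_subset_right

end genCube

/-! ### Polygons -/

/-- Two fixed-point free involutions `s₀`, `s₁`: `s₁` maps no element of an orbit of
`s₀ s₁` into the same orbit. -/
theorem involution_zpow_ne {X : Type*} {s₀ s₁ : Equiv.Perm X} (h₀ : s₀ * s₀ = 1)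
    (h₁ : s₁ * s₁ = 1) (f₀ : ∀ x, s₀ x ≠ x) (f₁ : ∀ x, s₁ x ≠ x) (b : X) (i j : ℤ) :
    s₁ (((s₀ * s₁) ^ i) b) ≠ ((s₀ * s₁) ^ j) b := by
  have e₀ : s₀⁻¹ = s₀ := inv_eq_of_mul_eq_one_left h₀
  have e₁ : s₁⁻¹ = s₁ := inv_eq_of_mul_eq_one_left h₁
  have hconj : ∀ k : ℤ, s₁ * (s₀ * s₁) ^ k * s₁ = (s₀ * s₁) ^ (-k) := by
    intro k
    have h2 : s₁ * (s₀ * s₁) * s₁⁻¹ = (s₀ * s₁)⁻¹ := by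
      rw [mul_inv_rev, e₀, e₁]; simp [mul_assoc, h₁]
    calc s₁ * (s₀ * s₁) ^ k * s₁ = s₁ * (s₀ * s₁) ^ k * s₁⁻¹ := by rw [e₁]
      _ = (s₁ * (s₀ * s₁) * s₁⁻¹) ^ k := conj_zpow.symm
      _ = _ := by rw [h2, inv_zpow, zpow_neg]
  have hcomm : ∀ k : ℤ, s₁ * (s₀ * s₁) ^ k = (s₀ * s₁) ^ (-k) * s₁ := by
    intro k
    rw [← hconj, mul_assoc _ s₁ s₁, h₁, mul_one]
  intro h
  rcases Int.even_or_odd' (i + j) with ⟨l, hl | hl⟩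
  · apply f₁ (((s₀ * s₁) ^ l) b)
    have h3 : ((s₀ * s₁) ^ (i - l) * (s₁ * (s₀ * s₁) ^ i)) b
        = ((s₀ * s₁) ^ (i - l) * (s₀ * s₁) ^ j) b := congrArg (⇑((s₀ * s₁) ^ (i - l))) h
    rw [hcomm, ← mul_assoc, ← zpow_add, ← zpow_add, show i - l + -i = -l by ring, ← hcomm,
      show i - l + j = l by omega] at h3
    exact h3
  · apply f₀ ((s₁ * (s₀ * s₁) ^ l) b)
    have h3 : ((s₀ * s₁) ^ (i - l) * (s₁ * (s₀ * s₁) ^ i)) b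
        = ((s₀ * s₁) ^ (i - l) * (s₀ * s₁) ^ j) b := congrArg (⇑((s₀ * s₁) ^ (i - l))) h
    rw [hcomm, ← mul_assoc, ← zpow_add, ← zpow_add, show i - l + -i = -l by ring, ← hcomm,
      show i - l + j = 1 + l by omega] at h3
    rw [zpow_one_add, mul_assoc] at h3
    exact h3.symm

/-- The flags of a polygon, listed cyclically. -/
theorem exists_cyclic_listing {X : Type*} {s₀ s₁ : Equiv.Perm X} (h₀ : s₀ * s₀ = 1)
    (h₁ : s₁ * s₁ = 1) (f₀ : ∀ x, s₀ x ≠ x) (f₁ : ∀ x, s₁ x ≠ x) (b : X)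
    (hconn : ∀ U : Set X, b ∈ U → (∀ x ∈ U, s₀ x ∈ U) → (∀ x ∈ U, s₁ x ∈ U) → ∀ x, x ∈ U) :
    ∃ (m : ℕ) (q : ZMod m → X), Function.Injective q ∧ q 0 = b ∧ (∀ i, q (i + 1) = s₀ (s₁ (q i))) ∧
      (∀ i j, s₁ (q i) ≠ q j) ∧ ∀ x, ∃ i, x = q i ∨ x = s₁ (q i) := by
  let e := MulAction.orbitZPowersEquiv (s₀ * s₁) b
  have he : ∀ k : ℤ, ((e.symm (k : ZMod _)) : X) = ((s₀ * s₁) ^ k) b := by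
    intro k
    rw [MulAction.orbitZPowersEquiv_symm_apply']
    rfl
  have hsucc : ∀ i, ((e.symm (i + 1)) : X) = s₀ (s₁ (e.symm i)) := by
    intro i
    obtain ⟨k, rfl⟩ := ZMod.intCast_surjective i
    have h2 : ((k : ZMod (Function.minimalPeriod ((s₀ * s₁) • ·) b)) + 1) = ((1 + k : ℤ) : ZMod _) := by
      push_cast; ring
    rw [h2, he, he, zpow_one_add]
    rfl
  have s₀s₀ : ∀ x, s₀ (s₀ x) = x := fun x => congrArg (fun t : Equiv.Perm X => t x) h₀
  have s₁s₁ : ∀ x, s₁ (s₁ x) = x := fun x => congrArg (fun t : Equiv.Perm X => t x) h₁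
  refine ⟨_, fun i => (e.symm i : X), Subtype.val_injective.comp e.symm.injective, ?_, hsucc, ?_, ?_⟩
  · have := he 0
    rwa [Int.cast_zero, zpow_zero] at this
  · intro i j
    obtain ⟨k, rfl⟩ := ZMod.intCast_surjective i
    obtain ⟨l, rfl⟩ := ZMod.intCast_surjective j
    simp only [he]
    exact involution_zpow_ne h₀ h₁ f₀ f₁ b k l
  · refine hconn {x | ∃ i, x = (e.symm i : X) ∨ x = s₁ (e.symm i)} ⟨0, Or.inl ?_⟩ ?_ ?_
    · have := he 0
      rw [Int.cast_zero, zpow_zero] at this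
      exact this.symm
    · rintro x ⟨i, rfl | rfl⟩
      · refine ⟨i - 1, Or.inr ?_⟩
        have := hsucc (i - 1)
        rw [sub_add_cancel] at this
        rw [this, s₀s₀]
      · exact ⟨i + 1, Or.inl (hsucc i).symm⟩
    · rintro x ⟨i, rfl | rfl⟩
      · exact ⟨i, Or.inr rfl⟩
      · exact ⟨i, Or.inl (s₁s₁ _)⟩

/-- A map with all fibres of size two determines a fixed-point free involution. -/
theorem exists_involution_of_fibres {X Y : Type*} (g : X → Y)
    (hg : ∀ x, ∃ x', (x' ≠ x ∧ g x' = g x) ∧ ∀ z, g z = g x → z = x ∨ z = x') :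
    ∃ s : Equiv.Perm X, s * s = 1 ∧ (∀ x, s x ≠ x) ∧ (∀ x, g (s x) = g x) ∧
      ∀ x z, g z = g x → z = x ∨ z = s x := by
  choose s hs hs' using hg
  have hinv : Function.Involutive s := by
    intro x
    rcases hs' x (s (s x)) ((hs (s x)).2.trans (hs x).2) with h | h
    · exact h
    · exact absurd h (hs (s x)).1
  exact ⟨hinv.toPerm, Equiv.ext hinv, fun x => (hs x).1, fun x => (hs x).2, hs'⟩

/-- The pairs of an incident vertex and edge of a polygon. -/
abbrev PolygonFlag (K : Type*) [PartialOrder K] (rk : K → ℤ) : Type _ :=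
  {q : K × K // rk q.1 = 0 ∧ rk q.2 = 1 ∧ q.1 < q.2}

theorem exists_other_of_ncard_eq_two {X : Type*} {s : Set X} (hs : s.ncard = 2) {a : X}
    (ha : a ∈ s) : ∃ b, b ∈ s ∧ b ≠ a ∧ ∀ c ∈ s, c = a ∨ c = b := by
  obtain ⟨x, y, hxy, rfl⟩ := Set.ncard_eq_two.1 hs
  rcases ha with rfl | rfl
  · exact ⟨y, by simp, hxy.symm, fun c hc => hc⟩
  · exact ⟨x, by simp, hxy, fun c hc => hc.symm⟩

section Polygon

variable {K : Type*} [PartialOrder K] {rk : K → ℤ}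

theorem exists_vertex_involution (hK : IsPolytope K rk 2) :
    ∃ s : Equiv.Perm (PolygonFlag K rk), s * s = 1 ∧ (∀ x, s x ≠ x) ∧
      (∀ x, (s x).1.2 = x.1.2) ∧ ∀ x z : PolygonFlag K rk, z.1.2 = x.1.2 → z = x ∨ z = s x := by
  refine exists_involution_of_fibres (fun q : PolygonFlag K rk => q.1.2) ?_
  rintro ⟨⟨v, E⟩, hv, hE, hvE⟩
  change rk v = 0 at hv
  change rk E = 1 at hE
  obtain ⟨b, hb, hb'⟩ := hK.1
  have lt_of : ∀ w, rk w = 0 → b < w := fun w hw => lt_of_le_of_ne (hb w) (by rintro rfl; omega)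
  obtain ⟨w, ⟨hw1, hw2⟩, hw3, hw4⟩ := exists_other_of_ncard_eq_two
    (hK.2.2.2.2.1 b E ((lt_of v hv).trans hvE) (by omega)) (a := v) ⟨lt_of v hv, hvE⟩
  have hw : rk w = 0 := by
    have := hK.rk_strictMono hw1
    have := hK.rk_strictMono hw2
    omega
  refine ⟨⟨⟨w, E⟩, hw, hE, hw2⟩, ⟨?_, rfl⟩, ?_⟩
  · intro h
    exact hw3 (congrArg (fun q : PolygonFlag K rk => q.1.1) h)
  · rintro ⟨⟨z, E'⟩, hz, hE', hzE⟩ rfl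
    rcases hw4 z ⟨lt_of z hz, hzE⟩ with rfl | rfl
    · exact Or.inl rfl
    · exact Or.inr rfl

theorem exists_edge_involution (hK : IsPolytope K rk 2) :
    ∃ s : Equiv.Perm (PolygonFlag K rk), s * s = 1 ∧ (∀ x, s x ≠ x) ∧
      (∀ x, (s x).1.1 = x.1.1) ∧ ∀ x z : PolygonFlag K rk, z.1.1 = x.1.1 → z = x ∨ z = s x := by
  refine exists_involution_of_fibres (fun q : PolygonFlag K rk => q.1.1) ?_
  rintro ⟨⟨v, E⟩, hv, hE, hvE⟩
  change rk v = 0 at hv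
  change rk E = 1 at hE
  obtain ⟨b, hb, hb'⟩ := hK.2.1
  have lt_of : ∀ w, rk w = 1 → w < b := fun w hw => lt_of_le_of_ne (hb w) (by
    rintro rfl; rw [hw] at hb'; norm_num at hb')
  obtain ⟨w, ⟨hw1, hw2⟩, hw3, hw4⟩ := exists_other_of_ncard_eq_two
    (hK.2.2.2.2.1 v b (hvE.trans (lt_of E hE)) (by push_cast at hb'; omega)) (a := E)
      ⟨hvE, lt_of E hE⟩
  have hw : rk w = 1 := by
    have := hK.rk_strictMono hw1
    have := hK.rk_strictMono hw2
    push_cast at hb'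
    omega
  refine ⟨⟨⟨v, w⟩, hv, hw, hw1⟩, ⟨?_, rfl⟩, ?_⟩
  · intro h
    exact hw3 (congrArg (fun q : PolygonFlag K rk => q.1.2) h)
  · rintro ⟨⟨v', z⟩, hv', hz, hvz⟩ rfl
    rcases hw4 z ⟨hvz, lt_of z hz⟩ with rfl | rfl
    · exact Or.inl rfl
    · exact Or.inr rfl

theorem PolygonFlag.exists_isMaxFlag (q : PolygonFlag K rk) :
    ∃ F, IsMaxFlag K F ∧ q.1.1 ∈ F ∧ q.1.2 ∈ F := by
  obtain ⟨F, hF, hs⟩ := exists_isMaxFlag_of_isChain (IsChain.pair (r := (· ≤ ·)) q.2.2.2.le)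
  exact ⟨F, hF, hs (by simp), hs (by simp)⟩

theorem PolygonFlag.connected (hK : IsPolytope K rk 2) {s₀ s₁ : PolygonFlag K rk → PolygonFlag K rk}
    (h₀ : ∀ x z : PolygonFlag K rk, z.1.2 = x.1.2 → z = x ∨ z = s₀ x)
    (h₁ : ∀ x z : PolygonFlag K rk, z.1.1 = x.1.1 → z = x ∨ z = s₁ x)
    {U : Set (PolygonFlag K rk)} {b : PolygonFlag K rk} (hb : b ∈ U)
    (hU₀ : ∀ x ∈ U, s₀ x ∈ U) (hU₁ : ∀ x ∈ U, s₁ x ∈ U) (x : PolygonFlag K rk) : x ∈ U := by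
  obtain ⟨F, hF, hF1, hF2⟩ := b.exists_isMaxFlag
  obtain ⟨G, hG, hG1, hG2⟩ := x.exists_isMaxFlag
  have hc := hK.flag_connected hF hG
  suffices H : ∀ G, Relation.ReflTransGen
      (fun A B => IsMaxFlag K A ∧ IsMaxFlag K B ∧ (A \ B).ncard = 1) F G → IsMaxFlag K G →
      ∀ z : PolygonFlag K rk, z.1.1 ∈ G → z.1.2 ∈ G → z ∈ U from H G hc hG x hG1 hG2
  intro G hc
  induction hc with
  | refl =>
    intro _ z hz1 hz2
    have : z = b := Subtype.ext (Prod.ext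
      (hK.eq_of_rk_eq hF hz1 hF1 (z.2.1.trans b.2.1.symm))
      (hK.eq_of_rk_eq hF hz2 hF2 (z.2.2.1.trans b.2.2.1.symm)))
    exact this ▸ hb
  | @tail A B _ hAB ih =>
    obtain ⟨hA, hB, h1⟩ := hAB
    intro _ z hz1 hz2
    obtain ⟨i, -, -, -, hs⟩ := hK.exists_rank_of_ncard_diff hB h1
    obtain ⟨v, hv, hvr⟩ := hK.exists_mem hA (k := 0) (by norm_num) (by norm_num)
    obtain ⟨E, hE, hEr⟩ := hK.exists_mem hA (k := 1) (by norm_num) (by norm_num)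
    have hvE : v < E := hK.lt_of_rk_lt hA hv hE (by omega)
    have hy := ih hA ⟨⟨v, E⟩, hvr, hEr, hvE⟩ hv hE
    by_cases hi : i = 0
    · have hE' : z.1.2 = E :=
        hK.eq_of_rk_eq hB hz2 (hs E hE (by omega)) (z.2.2.1.trans hEr.symm)
      rcases h₀ ⟨⟨v, E⟩, hvr, hEr, hvE⟩ z hE' with h | h
      · exact h ▸ hy
      · exact h ▸ hU₀ _ hy
    · have hv' : z.1.1 = v :=
        hK.eq_of_rk_eq hB hz1 (hs v hv (by omega)) (z.2.1.trans hvr.symm)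
      rcases h₁ ⟨⟨v, E⟩, hvr, hEr, hvE⟩ z hv' with h | h
      · exact h ▸ hy
      · exact h ▸ hU₁ _ hy

theorem exists_polygonFlag_vertex (hK : IsPolytope K rk 2) {v : K} (hv : rk v = 0) :
    ∃ q : PolygonFlag K rk, q.1.1 = v := by
  obtain ⟨F, hF, hvF⟩ := exists_isMaxFlag_mem v
  obtain ⟨E, hE, hEr⟩ := hK.exists_mem hF (k := 1) (by norm_num) (by norm_num)
  have hvE : v < E := hK.lt_of_rk_lt hF hvF hE (by omega)
  exact ⟨⟨⟨v, E⟩, hv, hEr, hvE⟩, rfl⟩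

theorem exists_polygonFlag_edge (hK : IsPolytope K rk 2) {E : K} (hE : rk E = 1) :
    ∃ q : PolygonFlag K rk, q.1.2 = E := by
  obtain ⟨F, hF, hEF⟩ := exists_isMaxFlag_mem E
  obtain ⟨v, hv, hvr⟩ := hK.exists_mem hF (k := 0) (by norm_num) (by norm_num)
  have hvE : v < E := hK.lt_of_rk_lt hF hv hEF (by omega)
  exact ⟨⟨⟨v, E⟩, hvr, hE, hvE⟩, rfl⟩

/-- The vertices and the edges of a polygon, listed cyclically from a given flag. -/
theorem exists_polygon_labelling (hK : IsPolytope K rk 2) {p : ℕ}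
    (hvert : Nat.card (polyVertices K rk) = p) (b : PolygonFlag K rk) :
    ∃ vert edge : ZMod p → K, vert 0 = b.1.1 ∧ edge 0 = b.1.2 ∧
      Function.Injective vert ∧ Function.Injective edge ∧
      (∀ x, rk x = 0 ↔ ∃ i, x = vert i) ∧ (∀ x, rk x = 1 ↔ ∃ i, x = edge i) ∧
      ∀ i j, vert i ≤ edge j ↔ j = i ∨ j = i + 1 := by
  obtain ⟨s₀, hs₀, f₀, e₀, u₀⟩ := exists_vertex_involution hK
  obtain ⟨s₁, hs₁, f₁, e₁, u₁⟩ := exists_edge_involution hK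
  obtain ⟨m, q, hq, hqb, hsucc, hne, hsurj⟩ := exists_cyclic_listing hs₀ hs₁ f₀ f₁ b
    fun U hb h0 h1 x => PolygonFlag.connected hK u₀ u₁ hb h0 h1 x
  have hedge : ∀ i, (s₁ (q i)).1.2 = (q (i + 1)).1.2 := fun i => by rw [hsucc, e₀]
  have hvinj : Function.Injective fun i => (q i).1.1 := by
    intro i j hij
    rcases u₁ (q i) (q j) hij.symm with h | h
    · exact (hq h).symm
    · exact absurd h.symm (hne i j)
  have heinj : Function.Injective fun i => (q i).1.2 := by
    intro i j hij
    rcases u₀ (q i) (q j) hij.symm with h | h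
    · exact (hq h).symm
    · refine absurd ?_ (hne (j - 1) i)
      have h2 := hsucc (j - 1)
      rw [sub_add_cancel, h] at h2
      exact (s₀.injective h2).symm
  have hv : ∀ x, rk x = 0 ↔ ∃ i, x = (q i).1.1 := by
    intro x
    constructor
    · intro hx
      obtain ⟨z, rfl⟩ := exists_polygonFlag_vertex hK hx
      obtain ⟨i, rfl | rfl⟩ := hsurj z
      · exact ⟨i, rfl⟩
      · exact ⟨i, e₁ _⟩
    · rintro ⟨i, rfl⟩
      exact (q i).2.1
  have he : ∀ x, rk x = 1 ↔ ∃ i, x = (q i).1.2 := by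
    intro x
    constructor
    · intro hx
      obtain ⟨z, rfl⟩ := exists_polygonFlag_edge hK hx
      obtain ⟨i, rfl | rfl⟩ := hsurj z
      · exact ⟨i, rfl⟩
      · exact ⟨i + 1, hedge i⟩
    · rintro ⟨i, rfl⟩
      exact (q i).2.2.1
  obtain rfl : m = p := by
    have : Nat.card (ZMod m) = Nat.card (polyVertices K rk) :=
      Nat.card_congr (Equiv.ofBijective (fun i => (⟨(q i).1.1, (q i).2.1⟩ : polyVertices K rk))
        ⟨fun i j h => hvinj (congrArg Subtype.val h), fun x => by
          obtain ⟨i, hi⟩ := (hv x.1).1 x.2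
          exact ⟨i, Subtype.ext hi.symm⟩⟩)
    rwa [Nat.card_zmod, hvert] at this
  refine ⟨fun i => (q i).1.1, fun i => (q i).1.2, by simp only [hqb], by simp only [hqb], hvinj, heinj, hv, he, ?_⟩
  intro i j
  constructor
  · intro h
    have hlt : (q i).1.1 < (q j).1.2 := lt_of_le_of_ne h fun h => by
      have h1 := (q i).2.1
      have h2 := (q j).2.2.1
      rw [h] at h1
      omega
    rcases u₁ (q i) ⟨⟨(q i).1.1, (q j).1.2⟩, (q i).2.1, (q j).2.2.1, hlt⟩ rfl with h | h
    · have h' := congrArg (fun z : PolygonFlag K rk => z.1.2) h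
      exact Or.inl (heinj h')
    · have h' := (congrArg (fun z : PolygonFlag K rk => z.1.2) h).trans (hedge i)
      exact Or.inr (heinj h')
  · rintro (rfl | rfl)
    · exact (q j).2.2.2.le
    · change (q i).1.1 ≤ (q (i + 1)).1.2
      rw [← hedge, ← e₁ (q i)]
      exact (s₁ (q i)).2.2.2.le

end Polygon

/-! ### Groups generated by two involutions -/

section Dihedral

variable {G : Type*} [Group G] {a b : G}

theorem mul_zpow_mul_of_involutions (ha : a * a = 1) (hb : b * b = 1) (k : ℤ) :
    a * (a * b) ^ k = (a * b) ^ (-k) * a := by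
  have ea : a⁻¹ = a := inv_eq_of_mul_eq_one_left ha
  have eb : b⁻¹ = b := inv_eq_of_mul_eq_one_left hb
  have h2 : a * (a * b) * a⁻¹ = (a * b)⁻¹ := by
    rw [mul_inv_rev, ea, eb, ← mul_assoc, ha, one_mul]
  have h3 := conj_zpow (i := k) (a := a) (b := a * b)
  rw [h2, inv_zpow, ← zpow_neg] at h3
  rw [h3, inv_mul_cancel_right]

theorem commute_of_mem_zpowers_mul (h : a ∈ Subgroup.zpowers (a * b)) : a * b = b * a := by
  obtain ⟨k, hk⟩ := Subgroup.mem_zpowers_iff.1 h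
  have h1 : a * (a * b) = a * b * a := by
    have h2 : (a * b) ^ k * (a * b) = a * b * (a * b) ^ k :=
      ((Commute.refl (a * b)).zpow_left k).eq
    rwa [hk] at h2
  rw [mul_assoc] at h1
  exact mul_left_cancel h1

theorem mem_zpowers_mul_or_of_mem_closure (ha : a * a = 1) (hb : b * b = 1) {g : G}
    (hg : g ∈ Subgroup.closure {a, b}) :
    g ∈ Subgroup.zpowers (a * b) ∨ g * a ∈ Subgroup.zpowers (a * b) := by
  have hL : ∀ g, (g ∈ Subgroup.zpowers (a * b) ∨ g * a ∈ Subgroup.zpowers (a * b)) →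
      a * g ∈ Subgroup.zpowers (a * b) ∨ a * g * a ∈ Subgroup.zpowers (a * b) := by
    rintro g (h | h)
    · obtain ⟨k, rfl⟩ := Subgroup.mem_zpowers_iff.1 h
      refine Or.inr ?_
      rw [mul_zpow_mul_of_involutions ha hb, mul_assoc, ha, mul_one]
      exact zpow_mem (Subgroup.mem_zpowers _) _
    · obtain ⟨k, hk⟩ := Subgroup.mem_zpowers_iff.1 h
      refine Or.inl ?_
      have : a * g = (a * b) ^ (-k) := by
        rw [← mul_left_inj a, ← mul_zpow_mul_of_involutions ha hb, hk, mul_assoc]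
      rw [this]
      exact zpow_mem (Subgroup.mem_zpowers _) _
  have hR : ∀ g, (g ∈ Subgroup.zpowers (a * b) ∨ g * a ∈ Subgroup.zpowers (a * b)) →
      b * g ∈ Subgroup.zpowers (a * b) ∨ b * g * a ∈ Subgroup.zpowers (a * b) := by
    intro g h
    have e : b * g = (a * b)⁻¹ * (a * g) * 1 := by
      rw [mul_inv_rev, inv_eq_of_mul_eq_one_left ha, inv_eq_of_mul_eq_one_left hb, mul_one]
      simp only [mul_assoc]
      rw [← mul_assoc a a, ha, one_mul]
    rw [mul_one] at e
    have hz := inv_mem (Subgroup.mem_zpowers (a * b))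
    rcases hL g h with h | h
    · exact Or.inl (by rw [e]; exact mul_mem hz h)
    · exact Or.inr (by rw [e, mul_assoc _ (a * g)]; exact mul_mem hz h)
  have ea : a⁻¹ = a := inv_eq_of_mul_eq_one_left ha
  have eb : b⁻¹ = b := inv_eq_of_mul_eq_one_left hb
  induction hg using Subgroup.closure_induction_left with
  | one => exact Or.inl (one_mem _)
  | mul_left x hx y _ ih =>
    rcases hx with rfl | rfl
    · exact hL _ ih
    · exact hR _ ih
  | inv_mul_cancel x hx y _ ih =>
    rcases hx with rfl | rfl
    · rw [ea]; exact hL _ ih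
    · rw [eb]; exact hR _ ih

theorem card_closure_pair_of_involutions (ha : a * a = 1) (hb : b * b = 1)
    (h : a ∉ Subgroup.zpowers (a * b)) :
    Nat.card (Subgroup.closure {a, b}) = 2 * orderOf (a * b) := by
  have ha' : a ∈ Subgroup.closure {a, b} := Subgroup.subset_closure (by simp)
  have hb' : b ∈ Subgroup.closure {a, b} := Subgroup.subset_closure (by simp)
  have hle : Subgroup.zpowers (a * b) ≤ Subgroup.closure {a, b} := by
    rw [Subgroup.zpowers_le]
    exact mul_mem ha' hb'
  have hidx : (Subgroup.zpowers (a * b)).relIndex (Subgroup.closure {a, b}) = 2 := by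
    rw [Subgroup.relIndex_eq_two_iff]
    refine ⟨a, ha', fun g hg => ?_⟩
    by_cases hz : g ∈ Subgroup.zpowers (a * b)
    · exact Or.inr ⟨hz, fun hga => h ((Subgroup.mul_mem_cancel_left _ hz).1 hga)⟩
    · exact Or.inl ⟨(mem_zpowers_mul_or_of_mem_closure ha hb hg).resolve_left hz, hz⟩
  have h2 := Subgroup.relIndex_mul_relIndex ⊥ _ _ bot_le hle
  rw [hidx, Subgroup.relIndex_bot_left, Subgroup.relIndex_bot_left, Nat.card_zpowers] at h2
  rw [← h2, mul_comm]

end Dihedral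

/-! ### Coset geometries -/

section RightCosets

variable {G : Type*} [Group G]

theorem mem_rCoset {H : Subgroup G} {g x : G} : x ∈ rCoset H g ↔ x * g⁻¹ ∈ H := Iff.rfl

theorem self_mem_rCoset (H : Subgroup G) (g : G) : g ∈ rCoset H g := by
  simp [mem_rCoset]

theorem rCoset_eq_of_mem {H : Subgroup G} {g x : G} (h : x ∈ rCoset H g) :
    rCoset H g = rCoset H x := by
  ext y
  rw [mem_rCoset, mem_rCoset, show y * x⁻¹ = y * g⁻¹ * (x * g⁻¹)⁻¹ by group,
    Subgroup.mul_mem_cancel_right _ (inv_mem h)]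

theorem card_rCosets_mul_card (H : Subgroup G) :
    Nat.card {s : Set G // ∃ g, s = rCoset H g} * Nat.card H = Nat.card G := by
  have e : G ⧸ H ≃ {s : Set G // ∃ g, s = rCoset H g} := by
    refine Equiv.ofBijective (Quotient.lift (fun g => ⟨rCoset H g⁻¹, _, rfl⟩) ?_) ⟨?_, ?_⟩
    · intro a b hab
      refine Subtype.ext (rCoset_eq_of_mem ?_)
      rw [mem_rCoset, inv_inv, ← inv_mem_iff, mul_inv_rev, inv_inv]
      exact QuotientGroup.leftRel_apply.1 hab
    · intro x y
      induction x using QuotientGroup.induction_on with | H a => ?_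
      induction y using QuotientGroup.induction_on with | H b => ?_
      intro hab
      have h1 : rCoset H a⁻¹ = rCoset H b⁻¹ := congrArg Subtype.val hab
      have h2 := self_mem_rCoset H b⁻¹
      rw [← h1, mem_rCoset, inv_inv] at h2
      refine QuotientGroup.eq.2 ?_
      simpa using inv_mem h2
    · rintro ⟨s, g, rfl⟩
      exact ⟨(g⁻¹ : G), Subtype.ext (by change rCoset H g⁻¹⁻¹ = _; rw [inv_inv])⟩
  rw [← Nat.card_congr e]
  exact (Subgroup.card_eq_card_quotient_mul_card_subgroup H).symm

end RightCosets

section CosetSystem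

variable {G : Type*} [Group G] {I : Type*} {Gi : I → Subgroup G}

/-- The element of type `i` of a coset incidence system containing `g`. -/
def cosetAt (Gi : I → Subgroup G) (i : I) (g : G) : cosetX Gi :=
  ⟨i, rCoset (Gi i) g, g, rfl⟩

theorem eq_cosetAt_of_mem {x : cosetX Gi} {g : G} (h : g ∈ x.2.1) : x = cosetAt Gi x.1 g := by
  obtain ⟨i, s, a, rfl⟩ := x
  exact Sigma.ext rfl (heq_of_eq (Subtype.ext (rCoset_eq_of_mem h)))

theorem cosetX_nonempty (x : cosetX Gi) : ∃ g, g ∈ x.2.1 := by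
  obtain ⟨i, s, a, rfl⟩ := x
  exact ⟨a, self_mem_rCoset _ _⟩

theorem mem_cosetAt {i : I} {g x : G} : x ∈ (cosetAt Gi i g).2.1 ↔ x * g⁻¹ ∈ Gi i := Iff.rfl

theorem cosetSystem_isSystem : (cosetSystem Gi).IsSystem := by
  refine ⟨fun x => ?_, fun x y h => ?_, fun x y h ht => ?_⟩
  · obtain ⟨g, hg⟩ := cosetX_nonempty x
    exact ⟨g, hg, hg⟩
  · obtain ⟨g, hg⟩ := h
    exact ⟨g, hg.2, hg.1⟩
  · obtain ⟨g, hg⟩ := h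
    rw [eq_cosetAt_of_mem hg.1, eq_cosetAt_of_mem hg.2]
    exact congrArg (fun i => cosetAt Gi i g) ht

/-- The chamber of all elements of a coset incidence system containing `g`. -/
def chamberAt (Gi : I → Subgroup G) (g : G) : Set (cosetX Gi) := {x | g ∈ x.2.1}

theorem isChamber_chamberAt (g : G) : (cosetSystem Gi).IsChamber (chamberAt Gi g) :=
  ⟨fun _ hx _ hy => ⟨g, hx, hy⟩,
    Set.eq_univ_of_forall fun i => ⟨cosetAt Gi i g, self_mem_rCoset _ _, rfl⟩⟩

/-- Every flag of the coset incidence system is a set of cosets with a common element. -/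
def FlagsMeet (Gi : I → Subgroup G) : Prop :=
  ∀ F : Set (cosetX Gi), (cosetSystem Gi).IsFlag F → ∃ g, F ⊆ chamberAt Gi g

namespace FlagsMeet

theorem isGeometry (h : FlagsMeet Gi) : (cosetSystem Gi).IsGeometry := by
  refine ⟨cosetSystem_isSystem, fun F hF => ?_⟩
  obtain ⟨g, hg⟩ := h F hF
  exact ⟨_, isChamber_chamberAt g, hg⟩

theorem exists_eq_chamberAt (h : FlagsMeet Gi) {C : Set (cosetX Gi)}
    (hC : (cosetSystem Gi).IsChamber C) : ∃ g, C = chamberAt Gi g := by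
  obtain ⟨g, hg⟩ := h C hC.1
  refine ⟨g, hg.antisymm fun x hx => ?_⟩
  obtain ⟨y, hy, hyx⟩ : x.1 ∈ (cosetSystem Gi).t '' C := hC.2 ▸ Set.mem_univ _
  exact cosetSystem_isSystem.2.2 y x ⟨g, hg hy, hx⟩ hyx ▸ hy

theorem chamberTransitive (h : FlagsMeet Gi) : (cosetSystem Gi).ChamberTransitive := by
  intro C D hC hD
  obtain ⟨a, rfl⟩ := h.exists_eq_chamberAt hC
  obtain ⟨b, rfl⟩ := h.exists_eq_chamberAt hD
  have hcomp : ∀ (a b : G) (x : cosetX Gi), cosetMul Gi a (cosetMul Gi b x) = cosetMul Gi (b * a) x := by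
    rintro a b ⟨i, s, hs⟩
    refine Sigma.ext rfl (heq_of_eq (Subtype.ext ?_))
    simp only [cosetMul, Set.image_image, mul_assoc]
  have hone : ∀ x : cosetX Gi, cosetMul Gi 1 x = x := by
    rintro ⟨i, s, hs⟩
    refine Sigma.ext rfl (heq_of_eq (Subtype.ext ?_))
    simp [cosetMul]
  let α (g : G) : Equiv.Perm (cosetX Gi) := ⟨cosetMul Gi g, cosetMul Gi g⁻¹,
    fun x => by rw [hcomp, mul_inv_cancel, hone], fun x => by rw [hcomp, inv_mul_cancel, hone]⟩
  refine ⟨α (a⁻¹ * b), ⟨fun x => rfl, fun x y => ?_⟩, ?_⟩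
  · change ((· * (a⁻¹ * b)) '' x.2.1 ∩ (· * (a⁻¹ * b)) '' y.2.1).Nonempty ↔ (x.2.1 ∩ y.2.1).Nonempty
    rw [← Set.image_inter (mul_left_injective _), Set.image_nonempty]
  · ext x
    constructor
    · rintro ⟨y, hy, rfl⟩
      exact ⟨a, hy, mul_inv_cancel_left a b⟩
    · intro hx
      refine ⟨cosetMul Gi (b⁻¹ * a) x, ⟨b, hx, mul_inv_cancel_left b a⟩, ?_⟩
      exact (hcomp _ _ x).trans ((congrArg (fun t => cosetMul Gi t x)
        (show b⁻¹ * a * (a⁻¹ * b) = 1 by group)).trans (hone x))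

theorem exists_of_mem_residueSet (h : FlagsMeet Gi) {F : Set (cosetX Gi)}
    (hF : (cosetSystem Gi).IsFlag F) {y : cosetX Gi}
    (hy : y ∈ (cosetSystem Gi).residueSet F) :
    y.1 ∉ (cosetSystem Gi).t '' F ∧ ∃ g, F ⊆ chamberAt Gi g ∧ y = cosetAt Gi y.1 g := by
  constructor
  · rintro ⟨z, hz, hzy⟩
    exact hy.1 (cosetSystem_isSystem.2.2 y z (hy.2 z hz) hzy.symm ▸ hz)
  · have hflag : (cosetSystem Gi).IsFlag (insert y F) := by
      rintro a (rfl | ha) b (rfl | hb)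
      · exact cosetSystem_isSystem.1 _
      · exact hy.2 b hb
      · exact cosetSystem_isSystem.2.1 _ _ (hy.2 a ha)
      · exact hF a ha b hb
    obtain ⟨g, hg⟩ := h _ hflag
    exact ⟨g, fun z hz => hg (Or.inr hz), eq_cosetAt_of_mem (hg (Or.inl rfl))⟩

theorem isThin (h : FlagsMeet Gi) {ρ : I → G}
    (hGi : ∀ (i : I) (g : G), (∀ j, j ≠ i → g ∈ Gi j) ↔ g = 1 ∨ g = ρ i)
    (hnot : ∀ i, ρ i ∉ Gi i) : (cosetSystem Gi).IsThin := by
  intro F hF hcard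
  obtain ⟨i, hi⟩ := Set.ncard_eq_one.1 hcard
  have hmem : ∀ j, j ∈ (cosetSystem Gi).t '' F ↔ j ≠ i := by
    intro j
    have : j ∈ Set.univ \ (cosetSystem Gi).t '' F ↔ j ∈ ({i} : Set I) := by rw [hi]
    simp only [Set.mem_sdiff, Set.mem_univ, true_and, Set.mem_singleton_iff] at this
    rw [← not_iff_not, this, not_not]
  obtain ⟨g, hg⟩ := h F hF
  have hsub : ∀ k, F ⊆ chamberAt Gi k ↔ k * g⁻¹ = 1 ∨ k * g⁻¹ = ρ i := by
    intro k
    rw [← hGi]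
    constructor
    · intro hk j hj
      obtain ⟨z, hz, rfl⟩ := (hmem j).2 hj
      have h1 := hk hz
      rw [eq_cosetAt_of_mem (hg hz)] at h1
      exact h1
    · intro hk z hz
      change k ∈ z.2.1
      rw [eq_cosetAt_of_mem (hg hz)]
      exact hk _ ((hmem _).1 ⟨z, hz, rfl⟩)
  have hres : (cosetSystem Gi).residueSet F = {cosetAt Gi i g, cosetAt Gi i (ρ i * g)} := by
    ext y
    constructor
    · intro hy
      obtain ⟨hy1, k, hk, hyk⟩ := h.exists_of_mem_residueSet hF hy
      have hyi : y.1 = i := by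
        by_contra hne
        exact hy1 ((hmem _).2 hne)
      rw [hyi] at hyk
      rcases (hsub k).1 hk with h1 | h1
      · left
        rw [hyk, mul_inv_eq_one.1 h1]
      · right
        exact hyk.trans (congrArg (cosetAt Gi i) (mul_inv_eq_iff_eq_mul.1 h1))
    · have key : ∀ k, F ⊆ chamberAt Gi k → cosetAt Gi i k ∈ (cosetSystem Gi).residueSet F := by
        intro k hk
        refine ⟨fun hF => (hmem i).1 ⟨_, hF, rfl⟩ rfl, fun z hz => ⟨k, self_mem_rCoset _ _, hk hz⟩⟩
      rintro (rfl | rfl)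
      · exact key _ hg
      · exact key _ ((hsub _).2 (Or.inr (by group)))
  refine (congrArg Set.ncard hres).trans (Set.ncard_pair fun heq => ?_)
  have h1 : ρ i * g ∈ (cosetAt Gi i g).2.1 := by
    rw [heq]
    exact self_mem_rCoset _ _
  rw [mem_cosetAt, mul_inv_cancel_right] at h1
  exact hnot i h1

theorem connOn_residueSet (h : FlagsMeet Gi) {ρ : I → G} {F : Set (cosetX Gi)}
    (hF : (cosetSystem Gi).IsFlag F) {J : Set I} (hJ : J = Set.univ \ (cosetSystem Gi).t '' F)
    (hJ2 : ∀ k ∈ J, ∃ l ∈ J, l ≠ k)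
    (hgen : ∀ k i, k ≠ i → ρ k ∈ Gi i)
    (hGi : ∀ g, (∀ j, j ∉ J → g ∈ Gi j) → g ∈ Subgroup.closure (ρ '' J)) :
    (cosetSystem Gi).ConnOn ((cosetSystem Gi).residueSet F) := by
  have hmem : ∀ j, j ∈ J ↔ j ∉ (cosetSystem Gi).t '' F := fun j => by simp [hJ]
  have hle : ∀ j, j ∉ J → Subgroup.closure (ρ '' J) ≤ Gi j := by
    intro j hj
    rw [Subgroup.closure_le]
    rintro _ ⟨k, hk, rfl⟩
    exact hgen k j fun h => hj (h ▸ hk)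
  have hin : ∀ j ∈ J, ∀ k, F ⊆ chamberAt Gi k →
      cosetAt Gi j k ∈ (cosetSystem Gi).residueSet F := by
    intro j hj k hk
    exact ⟨fun hF => (hmem j).1 hj ⟨_, hF, rfl⟩, fun z hz => ⟨k, self_mem_rCoset _ _, hk hz⟩⟩
  have hmul : ∀ g ∈ Subgroup.closure (ρ '' J), ∀ k, F ⊆ chamberAt Gi k →
      F ⊆ chamberAt Gi (g * k) := by
    intro g hg k hk z hz
    change g * k ∈ z.2.1
    rw [eq_cosetAt_of_mem (hk hz), mem_cosetAt, mul_inv_cancel_right]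
    exact hle _ (fun hJ => (hmem _).1 hJ ⟨z, hz, rfl⟩) hg
  intro x hx y hy
  obtain ⟨hx1, a, ha, hxa⟩ := h.exists_of_mem_residueSet hF hx
  obtain ⟨hy1, b, hb, hyb⟩ := h.exists_of_mem_residueSet hF hy
  have hba : b * a⁻¹ ∈ Subgroup.closure (ρ '' J) := by
    refine hGi _ fun j hj => ?_
    obtain ⟨z, hz, rfl⟩ := not_not.1 ((not_congr (hmem j)).1 hj)
    have h1 := hb hz
    rw [eq_cosetAt_of_mem (ha hz)] at h1
    exact h1
  have step : ∀ s ∈ Subgroup.closure (ρ '' J), (∃ k ∈ J, s = ρ k ∨ s = (ρ k)⁻¹) →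
      ∀ c, F ⊆ chamberAt Gi c → ∀ j ∈ J,
      (∀ j ∈ J, Relation.ReflTransGen (fun a b => a ∈ (cosetSystem Gi).residueSet F ∧
        b ∈ (cosetSystem Gi).residueSet F ∧ (cosetSystem Gi).inc a b) x (cosetAt Gi j c)) →
      Relation.ReflTransGen (fun a b => a ∈ (cosetSystem Gi).residueSet F ∧
        b ∈ (cosetSystem Gi).residueSet F ∧ (cosetSystem Gi).inc a b) x (cosetAt Gi j (s * c)) := by
    rintro s hs ⟨k, hk, hsk⟩ c hc j hj ih
    obtain ⟨l, hl, hlk⟩ := hJ2 k hk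
    refine (ih l hl).tail ⟨hin l hl c hc, hin j hj _ (hmul s hs c hc), s * c, ?_,
      self_mem_rCoset _ _⟩
    rw [mem_cosetAt, mul_inv_cancel_right]
    rcases hsk with rfl | rfl
    · exact hgen k l hlk.symm
    · exact inv_mem (hgen k l hlk.symm)
  have main : ∀ g ∈ Subgroup.closure (ρ '' J), ∀ j ∈ J,
      Relation.ReflTransGen (fun a b => a ∈ (cosetSystem Gi).residueSet F ∧
        b ∈ (cosetSystem Gi).residueSet F ∧ (cosetSystem Gi).inc a b) x
          (cosetAt Gi j (g * a)) := by
    intro g hg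
    induction hg using Subgroup.closure_induction_left with
    | one =>
      intro j hj
      rw [one_mul]
      exact Relation.ReflTransGen.single ⟨hx, hin j hj a ha, a, by
        rw [hxa]; exact self_mem_rCoset _ _, self_mem_rCoset _ _⟩
    | mul_left s hs g hg ih =>
      intro j hj
      rw [mul_assoc]
      obtain ⟨k, hk, rfl⟩ := hs
      exact step _ (Subgroup.subset_closure ⟨k, hk, rfl⟩) ⟨k, hk, Or.inl rfl⟩ _
        (hmul g hg a ha) j hj ih
    | inv_mul_cancel s hs g hg ih =>
      intro j hj
      rw [mul_assoc]
      obtain ⟨k, hk, rfl⟩ := hs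
      exact step _ (inv_mem (Subgroup.subset_closure ⟨k, hk, rfl⟩)) ⟨k, hk, Or.inr rfl⟩ _
        (hmul g hg a ha) j hj ih
  rw [hyb]
  have := main _ hba y.1 ((hmem _).2 hy1)
  rwa [inv_mul_cancel_right] at this

end FlagsMeet

theorem card_cosets_of_type (i : I) :
    Nat.card {x : (cosetSystem Gi).X // (cosetSystem Gi).t x = i} * Nat.card (Gi i) =
      Nat.card G := by
  rw [← card_rCosets_mul_card (Gi i)]
  congr 1
  refine Nat.card_congr ⟨fun x => ?_, fun s => ⟨⟨i, s⟩, rfl⟩, ?_, ?_⟩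
  · obtain ⟨⟨j, s⟩, hj⟩ := x
    exact ⟨s.1, by subst hj; exact s.2⟩
  · rintro ⟨⟨j, s⟩, rfl⟩
    rfl
  · intro s
    rfl

end CosetSystem

/-! ### Polyhedra as coset geometries -/

/-- The maximal standard parabolic subgroups of a generating family. -/
def maxParabolic {G I : Type*} [Group G] (ρ : I → G) (i : I) : Subgroup G :=
  Subgroup.closure (ρ '' {j | j ≠ i})

/-- Involutory generators `ρ₁ —p— ρ₀ —p— ρ₂` of a group of order `2 ^ p * p` with the intersection
property. -/
structure IsHalvedGens {G : Type*} [Group G] (ρ : Fin 3 → G) (p : ℕ) : Prop where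
  three_le : 3 ≤ p
  closure_eq_top : Subgroup.closure (Set.range ρ) = ⊤
  mul_self : ∀ i, ρ i * ρ i = 1
  orderOf_zero_one : orderOf (ρ 0 * ρ 1) = p
  orderOf_zero_two : orderOf (ρ 0 * ρ 2) = p
  orderOf_one_two : orderOf (ρ 1 * ρ 2) = 2
  inf_le : Subgroup.closure {ρ 0, ρ 1} ⊓ Subgroup.closure {ρ 0, ρ 2} ≤ Subgroup.zpowers (ρ 0)
  card_eq : Nat.card G = 2 ^ p * p

theorem mem_zpowers_of_mul_self {G : Type*} [Group G] {a g : G} (ha : a * a = 1) :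
    g ∈ Subgroup.zpowers a ↔ g = 1 ∨ g = a := by
  constructor
  · intro hg
    obtain ⟨k, rfl⟩ := Subgroup.mem_zpowers_iff.1 hg
    obtain ⟨l, rfl | rfl⟩ := Int.even_or_odd' k
    · left; rw [zpow_mul, zpow_two, ha, one_zpow]
    · right; rw [zpow_add, zpow_mul, zpow_two, ha, one_zpow, one_mul, zpow_one]
  · rintro (rfl | rfl)
    · exact one_mem _
    · exact Subgroup.mem_zpowers _

theorem mul_self_of_comm {G : Type*} [Group G] {a b : G} (ha : a * a = 1) (hb : b * b = 1)
    (h : a * b = b * a) : (a * b) ^ 2 = 1 := by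
  rw [pow_two]
  nth_rw 2 [h]
  rw [mul_assoc, ← mul_assoc b, hb, one_mul, ha]

theorem maxParabolic_zero {G : Type*} [Group G] (ρ : Fin 3 → G) :
    maxParabolic ρ 0 = Subgroup.closure {ρ 1, ρ 2} := by
  rw [maxParabolic, ← Set.image_pair]
  congr 2
  ext j; fin_cases j <;> simp

theorem maxParabolic_one {G : Type*} [Group G] (ρ : Fin 3 → G) :
    maxParabolic ρ 1 = Subgroup.closure {ρ 0, ρ 2} := by
  rw [maxParabolic, ← Set.image_pair]
  congr 2
  ext j; fin_cases j <;> simp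

theorem maxParabolic_two {G : Type*} [Group G] (ρ : Fin 3 → G) :
    maxParabolic ρ 2 = Subgroup.closure {ρ 0, ρ 1} := by
  rw [maxParabolic, ← Set.image_pair]
  congr 2
  ext j; fin_cases j <;> simp

theorem mem_maxParabolic {G I : Type*} [Group G] (ρ : I → G) {k i : I} (h : k ≠ i) :
    ρ k ∈ maxParabolic ρ i := Subgroup.subset_closure ⟨k, h, rfl⟩

namespace IsHalvedGens

variable {G : Type*} [Group G] {ρ : Fin 3 → G} {p : ℕ} (h : IsHalvedGens ρ p)
include h

theorem comm_one_two : ρ 1 * ρ 2 = ρ 2 * ρ 1 := by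
  have h1 := pow_orderOf_eq_one (ρ 1 * ρ 2)
  rw [h.orderOf_one_two, pow_two] at h1
  rw [eq_inv_of_mul_eq_one_left h1, mul_inv_rev, inv_eq_of_mul_eq_one_left (h.mul_self 1),
    inv_eq_of_mul_eq_one_left (h.mul_self 2)]

theorem not_comm_zero_one : ρ 0 * ρ 1 ≠ ρ 1 * ρ 0 := fun hc => by
  have := orderOf_dvd_of_pow_eq_one (mul_self_of_comm (h.mul_self 0) (h.mul_self 1) hc)
  rw [h.orderOf_zero_one] at this
  have := Nat.le_of_dvd (by norm_num) this
  have := h.three_le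
  omega

theorem not_comm_zero_two : ρ 0 * ρ 2 ≠ ρ 2 * ρ 0 := fun hc => by
  have := orderOf_dvd_of_pow_eq_one (mul_self_of_comm (h.mul_self 0) (h.mul_self 2) hc)
  rw [h.orderOf_zero_two] at this
  have := Nat.le_of_dvd (by norm_num) this
  have := h.three_le
  omega

theorem mem_maxParabolic_zero {g : G} :
    g ∈ maxParabolic ρ 0 ↔ g = 1 ∨ g = ρ 1 ∨ g = ρ 2 ∨ g = ρ 1 * ρ 2 := by
  have h12 : (ρ 1 * ρ 2) * (ρ 1 * ρ 2) = 1 := by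
    rw [← pow_two]
    exact mul_self_of_comm (h.mul_self 1) (h.mul_self 2) h.comm_one_two
  have e : ρ 1 * ρ 2 * ρ 1 = ρ 2 := by
    rw [h.comm_one_two, mul_assoc, h.mul_self, mul_one]
  have m1 : ρ 1 ∈ maxParabolic ρ 0 := mem_maxParabolic ρ (by decide)
  have m2 : ρ 2 ∈ maxParabolic ρ 0 := mem_maxParabolic ρ (by decide)
  constructor
  · intro hg
    rw [maxParabolic_zero] at hg
    rcases mem_zpowers_mul_or_of_mem_closure (h.mul_self 1) (h.mul_self 2) hg with h1 | h1 <;>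
      rcases (mem_zpowers_of_mul_self h12).1 h1 with h2 | h2
    · exact Or.inl h2
    · exact Or.inr (Or.inr (Or.inr h2))
    · exact Or.inr (Or.inl (mul_right_cancel (h2.trans (h.mul_self 1).symm)))
    · exact Or.inr (Or.inr (Or.inl (mul_right_cancel (h2.trans h.comm_one_two))))
  · rintro (rfl | rfl | rfl | rfl)
    · exact one_mem _
    · exact m1
    · exact m2
    · exact mul_mem m1 m2

theorem mem_one_inf_two {g : G} :
    g ∈ maxParabolic ρ 1 ∧ g ∈ maxParabolic ρ 2 ↔ g = 1 ∨ g = ρ 0 := by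
  rw [← mem_zpowers_of_mul_self (h.mul_self 0)]
  constructor
  · rintro ⟨h1, h2⟩
    rw [maxParabolic_one] at h1
    rw [maxParabolic_two] at h2
    exact h.inf_le ⟨h2, h1⟩
  · intro hg
    have : ∀ i : Fin 3, i ≠ 0 → Subgroup.zpowers (ρ 0) ≤ maxParabolic ρ i := fun i hi => by
      rw [Subgroup.zpowers_le]; exact mem_maxParabolic ρ hi.symm
    exact ⟨this 1 (by decide) hg, this 2 (by decide) hg⟩

theorem not_mem_maxParabolic (i : Fin 3) : ρ i ∉ maxParabolic ρ i := by
  have n1 : ρ 1 ≠ 1 := fun e => h.not_comm_zero_one (by rw [e, one_mul, mul_one])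
  have n2 : ρ 2 ≠ 1 := fun e => h.not_comm_zero_two (by rw [e, one_mul, mul_one])
  match i with
  | 0 =>
    intro hm
    refine h.not_comm_zero_one ?_
    rcases h.mem_maxParabolic_zero.1 hm with e | e | e | e <;> rw [e]
    · rw [one_mul, mul_one]
    · exact h.comm_one_two.symm
    · rw [mul_assoc, ← h.comm_one_two]
  | 1 =>
    intro hm
    rcases h.mem_one_inf_two.1 ⟨hm, mem_maxParabolic ρ (by decide)⟩ with e | e
    · exact n1 e
    · exact h.not_comm_zero_one (by rw [e])
  | 2 =>
    intro hm
    rcases h.mem_one_inf_two.1 ⟨mem_maxParabolic ρ (by decide), hm⟩ with e | e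
    · exact n2 e
    · exact h.not_comm_zero_two (by rw [e])

theorem forall_mem_maxParabolic_iff (i : Fin 3) (g : G) :
    (∀ j, j ≠ i → g ∈ maxParabolic ρ j) ↔ g = 1 ∨ g = ρ i := by
  constructor
  · intro hg
    match i with
    | 0 => exact h.mem_one_inf_two.1 ⟨hg 1 (by decide), hg 2 (by decide)⟩
    | 1 =>
      have n := h.not_mem_maxParabolic 2
      have g2 := hg 2 (by decide)
      have m : ρ 1 ∈ maxParabolic ρ 2 := mem_maxParabolic ρ (by decide)
      rcases h.mem_maxParabolic_zero.1 (hg 0 (by decide)) with e | e | e | e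
      · exact Or.inl e
      · exact Or.inr e
      · exact absurd (e ▸ g2) n
      · rw [e, Subgroup.mul_mem_cancel_left _ m] at g2
        exact absurd g2 n
    | 2 =>
      have n := h.not_mem_maxParabolic 1
      have g1 := hg 1 (by decide)
      have m : ρ 2 ∈ maxParabolic ρ 1 := mem_maxParabolic ρ (by decide)
      rcases h.mem_maxParabolic_zero.1 (hg 0 (by decide)) with e | e | e | e
      · exact Or.inl e
      · exact absurd (e ▸ g1) n
      · exact Or.inr e
      · rw [e, Subgroup.mul_mem_cancel_right _ m] at g1
        exact absurd g1 n
  · rintro (rfl | rfl) j hj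
    · exact one_mem _
    · exact mem_maxParabolic ρ hj.symm

theorem exists_common {a b c : cosetX (maxParabolic ρ)} (ha : a.1 = 0) (hb : b.1 = 1)
    (hc : c.1 = 2) (hab : (cosetSystem (maxParabolic ρ)).inc a b)
    (hac : (cosetSystem (maxParabolic ρ)).inc a c) :
    ∃ g, g ∈ a.2.1 ∧ g ∈ b.2.1 ∧ g ∈ c.2.1 := by
  obtain ⟨x, hxa, hxb⟩ := hab
  obtain ⟨y, hya, hyc⟩ := hac
  have ea := eq_cosetAt_of_mem hxa
  have eb := eq_cosetAt_of_mem hxb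
  have ec := eq_cosetAt_of_mem hyc
  rw [ha] at ea
  rw [hb] at eb
  rw [hc] at ec
  subst ea eb ec
  obtain ⟨s, t, hs2, ht1, ht0, hst⟩ : ∃ s t : G, s ∈ maxParabolic ρ 2 ∧ t ∈ maxParabolic ρ 1 ∧
      t ∈ maxParabolic ρ 0 ∧ y * x⁻¹ = s * t := by
    have m12 : ρ 1 ∈ maxParabolic ρ 2 := mem_maxParabolic ρ (by decide)
    have m21 : ρ 2 ∈ maxParabolic ρ 1 := mem_maxParabolic ρ (by decide)
    have m20 : ρ 2 ∈ maxParabolic ρ 0 := mem_maxParabolic ρ (by decide)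
    rcases h.mem_maxParabolic_zero.1 (mem_cosetAt.1 hya) with e | e | e | e
    · exact ⟨1, 1, one_mem _, one_mem _, one_mem _, by rw [e, one_mul]⟩
    · exact ⟨ρ 1, 1, m12, one_mem _, one_mem _, by rw [e, mul_one]⟩
    · exact ⟨1, ρ 2, one_mem _, m21, m20, by rw [e, one_mul]⟩
    · exact ⟨ρ 1, ρ 2, m12, m21, m20, e⟩
  refine ⟨t * x, ?_, ?_, ?_⟩
  · rwa [mem_cosetAt, mul_inv_cancel_right]
  · rwa [mem_cosetAt, mul_inv_cancel_right]
  · rw [mem_cosetAt]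
    have : t * x * y⁻¹ = s⁻¹ := by
      have hy : y = s * t * x := mul_inv_eq_iff_eq_mul.1 hst
      rw [hy]; group
    rw [this]
    exact inv_mem hs2

theorem flagsMeet : FlagsMeet (maxParabolic ρ) := by
  intro F hF
  have huniq : ∀ x ∈ F, ∀ y ∈ F, x.1 = y.1 → x = y := fun x hx y hy hxy =>
    cosetSystem_isSystem.2.2 x y (hF x hx y hy) hxy
  have key : ∀ i j : Fin 3, (∀ x ∈ F, x.1 = i ∨ x.1 = j) → ∃ g, F ⊆ chamberAt (maxParabolic ρ) g := by
    intro i j hij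
    by_cases hi : ∃ a ∈ F, a.1 = i
    · obtain ⟨a, ha, rfl⟩ := hi
      by_cases hj : ∃ b ∈ F, b.1 = j
      · obtain ⟨b, hb, rfl⟩ := hj
        obtain ⟨g, hga, hgb⟩ := hF a ha b hb
        refine ⟨g, fun x hx => ?_⟩
        rcases hij x hx with e | e
        · exact huniq x hx a ha e ▸ hga
        · exact huniq x hx b hb e ▸ hgb
      · obtain ⟨g, hg⟩ := cosetX_nonempty a
        refine ⟨g, fun x hx => ?_⟩
        rcases hij x hx with e | e
        · exact huniq x hx a ha e ▸ hg
        · exact absurd ⟨x, hx, e⟩ hj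
    · by_cases hj : ∃ b ∈ F, b.1 = j
      · obtain ⟨b, hb, rfl⟩ := hj
        obtain ⟨g, hg⟩ := cosetX_nonempty b
        refine ⟨g, fun x hx => ?_⟩
        rcases hij x hx with e | e
        · exact absurd ⟨x, hx, e⟩ hi
        · exact huniq x hx b hb e ▸ hg
      · refine ⟨1, fun x hx => ?_⟩
        rcases hij x hx with e | e
        · exact absurd ⟨x, hx, e⟩ hi
        · exact absurd ⟨x, hx, e⟩ hj
  have h3 : ∀ i : Fin 3, i = 0 ∨ i = 1 ∨ i = 2 := by decide
  by_cases h0 : ∃ a ∈ F, a.1 = 0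
  · by_cases h1 : ∃ b ∈ F, b.1 = 1
    · by_cases h2 : ∃ c ∈ F, c.1 = 2
      · obtain ⟨a, ha, ha0⟩ := h0
        obtain ⟨b, hb, hb1⟩ := h1
        obtain ⟨c, hc, hc2⟩ := h2
        obtain ⟨g, hga, hgb, hgc⟩ := h.exists_common ha0 hb1 hc2 (hF a ha b hb) (hF a ha c hc)
        refine ⟨g, fun x hx => ?_⟩
        rcases h3 x.1 with e | e | e
        · exact huniq x hx a ha (e.trans ha0.symm) ▸ hga
        · exact huniq x hx b hb (e.trans hb1.symm) ▸ hgb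
        · exact huniq x hx c hc (e.trans hc2.symm) ▸ hgc
      · exact key 0 1 fun x hx => by
          rcases h3 x.1 with e | e | e
          · exact Or.inl e
          · exact Or.inr e
          · exact absurd ⟨x, hx, e⟩ h2
    · exact key 0 2 fun x hx => by
        rcases h3 x.1 with e | e | e
        · exact Or.inl e
        · exact absurd ⟨x, hx, e⟩ h1
        · exact Or.inr e
  · exact key 1 2 fun x hx => (h3 x.1).resolve_left fun e => h0 ⟨x, hx, e⟩

theorem connOn_residueSet {F : Set (cosetX (maxParabolic ρ))}
    (hF : (cosetSystem (maxParabolic ρ)).IsFlag F)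
    (h2 : 2 ≤ (Set.univ \ (cosetSystem (maxParabolic ρ)).t '' F).ncard) :
    (cosetSystem (maxParabolic ρ)).ConnOn ((cosetSystem (maxParabolic ρ)).residueSet F) := by
  refine h.flagsMeet.connOn_residueSet (ρ := ρ) hF rfl
    (fun k _ => Set.exists_ne_of_one_lt_ncard h2 k) (fun k i hki => mem_maxParabolic ρ hki) ?_
  intro g hg
  set J := Set.univ \ (cosetSystem (maxParabolic ρ)).t '' F
  by_cases hJ : J = Set.univ
  · rw [hJ, Set.image_univ, h.closure_eq_top]
    exact Subgroup.mem_top _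
  · obtain ⟨i, hi⟩ := (Set.ne_univ_iff_exists_notMem _).1 hJ
    have hsub : J ⊆ {j | j ≠ i} := fun j hj e => hi (e ▸ hj)
    have hcard : ({j | j ≠ i} : Set (Fin 3)).ncard = 2 := by
      rw [show {j | j ≠ i} = (Set.univ : Set (Fin 3)) \ {i} by ext; simp,
        Set.ncard_sdiff_singleton_of_mem (Set.mem_univ i), Set.ncard_univ, Nat.card_fin]
    rw [Set.eq_of_subset_of_ncard_le hsub (by rw [hcard]; exact h2)]
    exact hg i hi

theorem isRegularHypertope : (cosetSystem (maxParabolic ρ)).IsRegularHypertope := by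
  refine ⟨⟨h.flagsMeet.isGeometry, h.flagsMeet.isThin h.forall_mem_maxParabolic_iff
    h.not_mem_maxParabolic, ?_, fun F hF h2 => h.connOn_residueSet hF h2⟩,
    h.flagsMeet.chamberTransitive⟩
  have h0 := h.connOn_residueSet (F := (∅ : Set (cosetSystem (maxParabolic ρ)).X))
    (fun _ hx => absurd hx (Set.notMem_empty _))
    (by rw [Set.image_empty, Set.sdiff_empty, Set.ncard_univ, Nat.card_fin]; norm_num)
  have e : (cosetSystem (maxParabolic ρ)).residueSet ∅ = Set.univ :=
    Set.eq_univ_of_forall fun x => ⟨Set.notMem_empty _, fun _ hy => absurd hy (Set.notMem_empty _)⟩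
  rwa [e] at h0

theorem card_zero : Nat.card {x : (cosetSystem (maxParabolic ρ)).X //
    (cosetSystem (maxParabolic ρ)).t x = 0} = 2 ^ (p - 2) * p := by
  have h1 := card_cosets_of_type (Gi := maxParabolic ρ) 0
  have hn : ρ 1 ∉ Subgroup.zpowers (ρ 1 * ρ 2) := by
    have h12 : (ρ 1 * ρ 2) * (ρ 1 * ρ 2) = 1 := by
      rw [← pow_two]
      exact mul_self_of_comm (h.mul_self 1) (h.mul_self 2) h.comm_one_two
    rw [mem_zpowers_of_mul_self h12]
    rintro (e | e)
    · exact h.not_comm_zero_one (by rw [e, one_mul, mul_one])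
    · have : ρ 2 = 1 := (left_eq_mul.1 e)
      exact h.not_comm_zero_two (by rw [this, one_mul, mul_one])
  have h2 : Nat.card (maxParabolic ρ 0) = 2 * 2 := by
    rw [maxParabolic_zero, card_closure_pair_of_involutions (h.mul_self 1) (h.mul_self 2) hn,
      h.orderOf_one_two]
  rw [h2, h.card_eq] at h1
  obtain ⟨q, rfl⟩ := Nat.exists_eq_add_of_le' h.three_le
  refine Nat.eq_of_mul_eq_mul_right (show 0 < 2 * 2 by norm_num) (h1.trans ?_)
  rw [show q + 3 - 2 = q + 1 by omega]
  ring

theorem card_of_ne_zero {i j : Fin 3} (hi : maxParabolic ρ i = Subgroup.closure {ρ 0, ρ j})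
    (hc : ρ 0 * ρ j ≠ ρ j * ρ 0) (ho : orderOf (ρ 0 * ρ j) = p) :
    Nat.card {x : (cosetSystem (maxParabolic ρ)).X //
      (cosetSystem (maxParabolic ρ)).t x = i} = 2 ^ (p - 1) := by
  have h1 := card_cosets_of_type (Gi := maxParabolic ρ) i
  have h2 : Nat.card (maxParabolic ρ i) = 2 * p := by
    rw [hi, card_closure_pair_of_involutions (h.mul_self 0) (h.mul_self j)
      (fun hz => hc (commute_of_mem_zpowers_mul hz)), ho]
  rw [h2, h.card_eq] at h1
  obtain ⟨q, rfl⟩ := Nat.exists_eq_add_of_le' h.three_le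
  refine Nat.eq_of_mul_eq_mul_right (show 0 < 2 * (q + 3) by positivity) (h1.trans ?_)
  rw [show q + 3 - 1 = q + 2 by omega]
  ring

theorem card_one : Nat.card {x : (cosetSystem (maxParabolic ρ)).X //
    (cosetSystem (maxParabolic ρ)).t x = 1} = 2 ^ (p - 1) :=
  h.card_of_ne_zero (maxParabolic_one ρ) h.not_comm_zero_two h.orderOf_zero_two

theorem card_two : Nat.card {x : (cosetSystem (maxParabolic ρ)).X //
    (cosetSystem (maxParabolic ρ)).t x = 2} = 2 ^ (p - 1) :=
  h.card_of_ne_zero (maxParabolic_two ρ) h.not_comm_zero_one h.orderOf_zero_one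

end IsHalvedGens

/-! ### Halving -/

/-- Involutory generators `ϱ₀ —p— ϱ₁ —4— ϱ₂` whose halving group has order `2 ^ p * p` and has the
intersection property. -/
structure IsHalvableGens {G : Type*} [Group G] (ϱ : Fin 3 → G) (p : ℕ) : Prop where
  three_le : 3 ≤ p
  mul_self : ∀ i, ϱ i * ϱ i = 1
  comm : ϱ 0 * ϱ 2 = ϱ 2 * ϱ 0
  orderOf_zero_one : orderOf (ϱ 0 * ϱ 1) = p
  orderOf_one_two : orderOf (ϱ 1 * ϱ 2) = 4
  inf_le : Subgroup.closure {ϱ 0, ϱ 1} ⊓ Subgroup.closure {ϱ 0, ϱ 2 * ϱ 1 * ϱ 2} ≤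
    Subgroup.zpowers (ϱ 0)
  card_eq : Nat.card (Subgroup.closure (Set.range (halvingGens 3 ϱ))) = 2 ^ p * p

section Halving

variable {G : Type*} [Group G]

theorem halvingGens_zero (ϱ : Fin 3 → G) : halvingGens 3 ϱ 0 = ϱ 0 := rfl

theorem halvingGens_one (ϱ : Fin 3 → G) : halvingGens 3 ϱ 1 = ϱ 1 := rfl

theorem halvingGens_two (ϱ : Fin 3 → G) : halvingGens 3 ϱ 2 = ϱ 2 * ϱ 1 * ϱ 2 := rfl

theorem halvingGens_map {H : Type*} [Group H] (f : G →* H) (ϱ : Fin 3 → G) :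
    halvingGens 3 (fun i => f (ϱ i)) = fun i => f (halvingGens 3 ϱ i) := by
  funext i
  match i with
  | 0 => rfl
  | 1 => rfl
  | 2 => exact (by rw [halvingGens_two, halvingGens_two, map_mul, map_mul])

theorem closure_range_liftGens {I : Type*} (ρ : I → G) :
    Subgroup.closure (Set.range (liftGens ρ)) = ⊤ := by
  rw [← Subgroup.closure_closure_coe_preimage (k := Set.range ρ)]
  congr 1
  ext x
  constructor
  · rintro ⟨i, rfl⟩
    exact ⟨i, rfl⟩
  · rintro ⟨i, hi⟩
    exact ⟨i, Subtype.ext hi⟩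

theorem coe_mem_closure_pair {I : Type*} {ρ : I → G} {i j : I}
    {x : Subgroup.closure (Set.range ρ)} (hx : x ∈ Subgroup.closure {liftGens ρ i, liftGens ρ j}) :
    (x : G) ∈ Subgroup.closure {ρ i, ρ j} := by
  have h := Subgroup.mem_map_of_mem (Subgroup.closure (Set.range ρ)).subtype hx
  rw [MonoidHom.map_closure, Set.image_pair] at h
  exact h

namespace IsHalvableGens

theorem map {ϱ : Fin 3 → G} {p : ℕ} (h : IsHalvableGens ϱ p) {H : Type*} [Group H] {f : G →* H}
    (hf : Function.Injective f) : IsHalvableGens (fun i => f (ϱ i)) p where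
  three_le := h.three_le
  mul_self i := by rw [← map_mul, h.mul_self, map_one]
  comm := by rw [← map_mul, h.comm, map_mul]
  orderOf_zero_one := by rw [← map_mul, orderOf_injective f hf, h.orderOf_zero_one]
  orderOf_one_two := by rw [← map_mul, orderOf_injective f hf, h.orderOf_one_two]
  inf_le := by
    rw [← map_mul, ← map_mul, ← Set.image_pair f, ← Set.image_pair f, ← MonoidHom.map_closure,
      ← MonoidHom.map_closure, ← Subgroup.map_inf _ _ f hf, ← MonoidHom.map_zpowers]
    exact Subgroup.map_mono h.inf_le
  card_eq := by
    have e : Set.range (halvingGens 3 fun i => f (ϱ i)) = f '' Set.range (halvingGens 3 ϱ) := by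
      rw [halvingGens_map, ← Set.range_comp]
      rfl
    rw [e, ← MonoidHom.map_closure, Subgroup.card_map_of_injective hf, h.card_eq]

variable {ϱ : Fin 3 → G} {p : ℕ} (h : IsHalvableGens ϱ p)
include h

theorem inv_eq (i : Fin 3) : (ϱ i)⁻¹ = ϱ i := inv_eq_of_mul_eq_one_left (h.mul_self i)

theorem conj_zero : ϱ 2 * ϱ 0 * ϱ 2 = ϱ 0 := by
  rw [← h.comm, mul_assoc, h.mul_self, mul_one]

theorem conj_two : ϱ 2 * (ϱ 2 * ϱ 1 * ϱ 2) * ϱ 2 = ϱ 1 := by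
  simp only [mul_assoc, h.mul_self, mul_one]
  rw [← mul_assoc, h.mul_self, one_mul]

theorem orderOf_halving_zero_two : orderOf (halvingGens 3 ϱ 0 * halvingGens 3 ϱ 2) = p := by
  rw [halvingGens_zero, halvingGens_two]
  have e : ϱ 0 * (ϱ 2 * ϱ 1 * ϱ 2) = MulAut.conj (ϱ 2) (ϱ 0 * ϱ 1) := by
    rw [MulAut.conj_apply, h.inv_eq, ← mul_assoc, ← mul_assoc, ← mul_assoc, h.comm]
  rw [e, MulEquiv.orderOf_eq]
  exact h.orderOf_zero_one

theorem orderOf_halving_one_two : orderOf (halvingGens 3 ϱ 1 * halvingGens 3 ϱ 2) = 2 := by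
  have e : halvingGens 3 ϱ 1 * halvingGens 3 ϱ 2 = (ϱ 1 * ϱ 2) ^ 2 := by
    rw [halvingGens_one, halvingGens_two, pow_two]
    simp only [mul_assoc]
  rw [e, orderOf_pow_of_dvd two_ne_zero (by rw [h.orderOf_one_two]; norm_num), h.orderOf_one_two]

theorem halvingGens_mul_self (i : Fin 3) : halvingGens 3 ϱ i * halvingGens 3 ϱ i = 1 := by
  match i with
  | 0 => exact h.mul_self 0
  | 1 => exact h.mul_self 1
  | 2 =>
    rw [halvingGens_two, ← mul_assoc, ← mul_assoc, mul_assoc (ϱ 2 * ϱ 1) (ϱ 2), h.mul_self,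
      mul_one, mul_assoc (ϱ 2), h.mul_self, mul_one, h.mul_self]

theorem isHalvedGens : IsHalvedGens (liftGens (halvingGens 3 ϱ)) p where
  three_le := h.three_le
  closure_eq_top := closure_range_liftGens _
  mul_self i := Subtype.ext (h.halvingGens_mul_self i)
  orderOf_zero_one := (Subgroup.orderOf_coe _).symm.trans h.orderOf_zero_one
  orderOf_zero_two := (Subgroup.orderOf_coe _).symm.trans h.orderOf_halving_zero_two
  orderOf_one_two := (Subgroup.orderOf_coe _).symm.trans h.orderOf_halving_one_two
  inf_le := by
    intro x hx
    have h1 := coe_mem_closure_pair (Subgroup.mem_inf.1 hx).1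
    have h2 := coe_mem_closure_pair (Subgroup.mem_inf.1 hx).2
    have h3 : (x : G) ∈ Subgroup.zpowers (halvingGens 3 ϱ 0) :=
      h.inf_le (Subgroup.mem_inf.2 ⟨h1, h2⟩)
    rw [mem_zpowers_of_mul_self (h.halvingGens_mul_self 0)] at h3
    rw [mem_zpowers_of_mul_self (Subtype.ext (h.halvingGens_mul_self 0))]
    exact h3.imp (fun e => Subtype.ext e) fun e => Subtype.ext e
  card_eq := h.card_eq

theorem exists_mulAut : ∃ σ : MulAut ↥(Subgroup.closure (Set.range (halvingGens 3 ϱ))),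
    σ (liftGens (halvingGens 3 ϱ) 0) = liftGens (halvingGens 3 ϱ) 0 ∧
    σ (liftGens (halvingGens 3 ϱ) 1) = liftGens (halvingGens 3 ϱ) 2 ∧
    σ (liftGens (halvingGens 3 ϱ) 2) = liftGens (halvingGens 3 ϱ) 1 := by
  have c (g : G) : MulAut.conj (ϱ 2) g = ϱ 2 * g * ϱ 2 := by rw [MulAut.conj_apply, h.inv_eq]
  have c0 : MulAut.conj (ϱ 2) (halvingGens 3 ϱ 0) = halvingGens 3 ϱ 0 := (c _).trans h.conj_zero
  have c1 : MulAut.conj (ϱ 2) (halvingGens 3 ϱ 1) = halvingGens 3 ϱ 2 := c _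
  have c2 : MulAut.conj (ϱ 2) (halvingGens 3 ϱ 2) = halvingGens 3 ϱ 1 := (c _).trans h.conj_two
  have hmap : (Subgroup.closure (Set.range (halvingGens 3 ϱ))).map (MulAut.conj (ϱ 2)).toMonoidHom =
      Subgroup.closure (Set.range (halvingGens 3 ϱ)) := by
    rw [MonoidHom.map_closure]
    congr 1
    ext x
    constructor
    · rintro ⟨_, ⟨i, rfl⟩, rfl⟩
      match i with
      | 0 => exact ⟨0, c0.symm⟩
      | 1 => exact ⟨2, c1.symm⟩
      | 2 => exact ⟨1, c2.symm⟩
    · rintro ⟨i, rfl⟩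
      match i with
      | 0 => exact ⟨_, ⟨0, rfl⟩, c0⟩
      | 1 => exact ⟨_, ⟨2, rfl⟩, c2⟩
      | 2 => exact ⟨_, ⟨1, rfl⟩, c1⟩
  exact ⟨((MulAut.conj (ϱ 2)).subgroupMap _).trans (MulEquiv.subgroupCongr hmap),
    Subtype.ext c0, Subtype.ext c1, Subtype.ext c2⟩

end IsHalvableGens

end Halving

/-! ### The signed dihedral group -/

namespace SignedDihedral

/-- The dihedral group acts on `ℤ/n` by rotations `k ↦ k + i` and reflections `k ↦ -(k + i)`. -/
instance instMulAction (n : ℕ) : MulAction (DihedralGroup n) (ZMod n) where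
  smul
    | .r i, k => k + i
    | .sr i, k => -(k + i)
  one_smul k := add_zero k
  mul_smul
    | .r i, .r j, k => show k + (i + j) = k + j + i by ring
    | .r i, .sr j, k => show -(k + (j - i)) = -(k + j) + i by ring
    | .sr i, .r j, k => show -(k + (i + j)) = -(k + j + i) by ring
    | .sr i, .sr j, k => show k + (j - i) = -(-(k + j) + i) by ring

theorem r_smul {n : ℕ} (i k : ZMod n) : DihedralGroup.r i • k = k + i := rfl

theorem sr_smul {n : ℕ} (i k : ZMod n) : DihedralGroup.sr i • k = -(k + i) := rfl

/-- Signed permutations of `ℤ/n` whose underlying permutation is dihedral. -/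
abbrev Carrier (n : ℕ) : Type :=
  (ZMod n → ℤˣ) ⋊[mulAutArrow] DihedralGroup n

variable {n : ℕ}

/-- The sign change at the coordinate `i`. -/
def negAt (i : ZMod n) : Carrier n := SemidirectProduct.inl (Pi.mulSingle i (-1))

/-- The dihedral permutations. -/
def rot (g : DihedralGroup n) : Carrier n := SemidirectProduct.inr g

/-- The standard generators. -/
def gens (n : ℕ) : Fin 3 → Carrier n :=
  ![rot (.sr 0), rot (.sr (-1)), negAt 0]

theorem gens_zero : gens n 0 = rot (.sr 0) := rfl
theorem gens_one : gens n 1 = rot (.sr (-1)) := rfl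
theorem gens_two : gens n 2 = negAt 0 := rfl

theorem mulAutArrow_mulSingle (g : DihedralGroup n) (i : ZMod n) (u : ℤˣ) :
    mulAutArrow g (Pi.mulSingle i u : ZMod n → ℤˣ) = Pi.mulSingle (g • i) u := by
  funext k
  rw [mulAutArrow_apply_apply]
  change (Pi.mulSingle i u : ZMod n → ℤˣ) (g⁻¹ • k) = _
  simp only [Pi.mulSingle_apply, inv_smul_eq_iff]

theorem rot_mul (g h : DihedralGroup n) : rot (g * h) = rot g * rot h :=
  map_mul SemidirectProduct.inr g h

theorem rot_mul_negAt (g : DihedralGroup n) (i : ZMod n) :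
    rot g * negAt i = negAt (g • i) * rot g := by
  have h := SemidirectProduct.inl_aut (φ := mulAutArrow) g (Pi.mulSingle i (-1) : ZMod n → ℤˣ)
  rw [mulAutArrow_mulSingle] at h
  rw [negAt, negAt, h, rot, map_inv, inv_mul_cancel_right]

theorem negAt_mul_negAt_self (i : ZMod n) : negAt i * negAt i = 1 := by
  rw [negAt, ← map_mul, ← Pi.mulSingle_mul]
  simp

theorem negAt_mul_negAt_comm (i j : ZMod n) : negAt i * negAt j = negAt j * negAt i := by
  rw [negAt, negAt, ← map_mul, ← map_mul, mul_comm]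

theorem rot_mem_range (g : DihedralGroup n) :
    rot g ∈ (SemidirectProduct.inr : DihedralGroup n →* Carrier n).range := ⟨g, rfl⟩

theorem gens_mul_self (i : Fin 3) : gens n i * gens n i = 1 := by
  match i with
  | 0 => rw [gens_zero, ← rot_mul, DihedralGroup.sr_mul_self]; exact map_one _
  | 1 => rw [gens_one, ← rot_mul, DihedralGroup.sr_mul_self]; exact map_one _
  | 2 => exact negAt_mul_negAt_self 0

theorem gens_inv (i : Fin 3) : (gens n i)⁻¹ = gens n i :=
  inv_eq_of_mul_eq_one_left (gens_mul_self i)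

theorem gens_comm : gens n 0 * gens n 2 = gens n 2 * gens n 0 := by
  rw [gens_zero, gens_two, rot_mul_negAt, sr_smul, add_zero, neg_zero]

theorem orderOf_gens_zero_one : orderOf (gens n 0 * gens n 1) = n := by
  rw [gens_zero, gens_one, ← rot_mul, DihedralGroup.sr_mul_sr, rot,
    orderOf_injective _ SemidirectProduct.inr_injective, sub_zero, ← DihedralGroup.inv_r, orderOf_inv,
    DihedralGroup.orderOf_r_one]

theorem gens_two_one_two : gens n 2 * gens n 1 * gens n 2 = negAt 0 * negAt 1 * gens n 1 := by
  rw [gens_two, gens_one, mul_assoc, rot_mul_negAt, sr_smul, ← mul_assoc, zero_add, neg_neg]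

theorem negAt_zero_mul_negAt_one : negAt (n := n) 0 * negAt 1 = (gens n 2 * gens n 1) ^ 2 := by
  rw [pow_two, ← mul_assoc, gens_two_one_two, mul_assoc, gens_mul_self, mul_one]

theorem left_negAt_mul_negAt (i j k : ZMod n) (g : DihedralGroup n) :
    (negAt i * negAt j * rot g).left k = (if k = i then -1 else 1) * if k = j then -1 else 1 := by
  rw [negAt, negAt, ← map_mul, rot]
  simp [Pi.mulSingle_apply]

theorem eq_of_negAt_mul_negAt_mul_rot {i j : ZMod n} {g h : DihedralGroup n}
    (e : negAt i * negAt j * rot g = rot h) : i = j := by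
  by_contra hij
  have h1 := left_negAt_mul_negAt i j i g
  rw [e, if_pos rfl, if_neg hij] at h1
  simp [rot] at h1

theorem orderOf_gens_one_two [Fact (1 < n)] : orderOf (gens n 1 * gens n 2) = 4 := by
  have e1 : orderOf (gens n 2 * gens n 1) = 2 ^ (1 + 1) := by
    refine orderOf_eq_prime_pow (p := 2) (n := 1) ?_ ?_
    · rw [pow_one, ← negAt_zero_mul_negAt_one]
      intro h
      refine zero_ne_one (α := ZMod n) (eq_of_negAt_mul_negAt_mul_rot (g := 1) (h := 1) ?_)
      rw [h, one_mul]
    · rw [pow_succ, pow_one, pow_mul, ← negAt_zero_mul_negAt_one, pow_two, mul_assoc,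
        ← mul_assoc (negAt 1), negAt_mul_negAt_comm 1, mul_assoc (negAt 0), negAt_mul_negAt_self, mul_one,
        negAt_mul_negAt_self]
  rw [← orderOf_inv, mul_inv_rev, gens_inv, gens_inv, e1]
  rfl

theorem gens_inf_le : Subgroup.closure {gens n 0, gens n 1} ⊓
    Subgroup.closure {gens n 0, gens n 2 * gens n 1 * gens n 2} ≤
      Subgroup.zpowers (gens n 0) := by
  set R := (SemidirectProduct.inr : DihedralGroup n →* Carrier n).range
  have h1 : Subgroup.closure {gens n 0, gens n 1} ≤ R := by
    rw [Subgroup.closure_le]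
    rintro _ (rfl | rfl)
    · exact rot_mem_range _
    · exact rot_mem_range _
  have h2 : Subgroup.closure {gens n 0, gens n 2 * gens n 1 * gens n 2} ≤
      R.comap (MulAut.conj (gens n 2)).toMonoidHom := by
    rw [Subgroup.closure_le]
    rintro _ (rfl | rfl)
    · change gens n 2 * gens n 0 * (gens n 2)⁻¹ ∈ R
      rw [← gens_comm, mul_inv_cancel_right]
      exact rot_mem_range _
    · change gens n 2 * (gens n 2 * gens n 1 * gens n 2) * (gens n 2)⁻¹ ∈ R
      rw [← mul_assoc, mul_inv_cancel_right, ← mul_assoc, gens_mul_self, one_mul]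
      exact rot_mem_range _
  intro x hx
  obtain ⟨g, rfl⟩ := h1 hx.1
  obtain ⟨h, hh⟩ := h2 hx.2
  replace hh : rot h = gens n 2 * rot g * (gens n 2)⁻¹ := hh
  rw [gens_inv, gens_two, mul_assoc,
    rot_mul_negAt, ← mul_assoc] at hh
  have h0 := eq_of_negAt_mul_negAt_mul_rot hh.symm
  rw [mem_zpowers_of_mul_self (gens_mul_self 0)]
  match g with
  | .r i =>
    left
    rw [r_smul, zero_add] at h0
    rw [← h0]
    exact map_one _
  | .sr i =>
    right
    rw [sr_smul, zero_add, eq_comm, neg_eq_zero] at h0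
    rw [h0]
    rfl

/-- The product of all signs. -/
def parity (n : ℕ) [NeZero n] : Carrier n →* ℤˣ :=
  SemidirectProduct.lift (∏ i, Pi.evalMonoidHom (fun _ => ℤˣ) i) 1 (by
    intro g
    refine MonoidHom.ext fun f => ?_
    simp only [MonoidHom.comp_apply, MonoidHom.finsetProd_apply, Pi.evalMonoidHom_apply,
      MonoidHom.one_apply, MulEquiv.coe_toMonoidHom, map_one, MulAut.one_apply]
    exact Equiv.prod_comp (MulAction.toPerm g⁻¹) f)

section

variable [NeZero n]

theorem parity_rot (g : DihedralGroup n) : parity n (rot g) = 1 :=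
  SemidirectProduct.lift_inr _ _ _ g

theorem parity_inl (f : ZMod n → ℤˣ) : parity n (SemidirectProduct.inl f) = ∏ i, f i := by
  rw [parity, SemidirectProduct.lift_inl, MonoidHom.finsetProd_apply]
  rfl

theorem parity_negAt (i : ZMod n) : parity n (negAt i) = -1 := by
  rw [negAt, parity_inl, Finset.prod_pi_mulSingle']
  simp

theorem closure_halvingGens : Subgroup.closure (Set.range (halvingGens 3 (gens n))) =
    (parity n).ker := by
  set C := Subgroup.closure (Set.range (halvingGens 3 (gens n)))
  have m0 : gens n 0 ∈ C := Subgroup.subset_closure ⟨0, rfl⟩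
  have m1 : gens n 1 ∈ C := Subgroup.subset_closure ⟨1, rfl⟩
  have m2 : gens n 2 * gens n 1 * gens n 2 ∈ C := Subgroup.subset_closure ⟨2, rfl⟩
  have mr (i : ZMod n) : rot (.r i) ∈ C := by
    have h : rot (.r i) = (gens n 1 * gens n 0) ^ i.val := by
      rw [gens_zero, gens_one, ← rot_mul, DihedralGroup.sr_mul_sr, zero_sub, neg_neg]
      refine Eq.trans ?_ (map_pow SemidirectProduct.inr _ _)
      rw [DihedralGroup.r_one_pow, ZMod.natCast_zmod_val, rot]
    rw [h]
    exact C.pow_mem (C.mul_mem m1 m0) _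
  have mrot (g : DihedralGroup n) : rot g ∈ C := by
    match g with
    | .r i => exact mr i
    | .sr i =>
      have h : rot (.sr i) = gens n 0 * rot (.r i) := by
        rw [gens_zero, ← rot_mul, DihedralGroup.sr_mul_r, zero_add]
      rw [h]
      exact C.mul_mem m0 (mr i)
  have mnegAt (i : ZMod n) : negAt i * negAt (i + 1) ∈ C := by
    have h : negAt i * negAt (i + 1) = rot (.r i) * (negAt 0 * negAt 1) * (rot (.r i))⁻¹ := by
      rw [← mul_assoc, rot_mul_negAt, mul_assoc (negAt _), rot_mul_negAt, ← mul_assoc,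
        mul_inv_cancel_right, r_smul, r_smul, zero_add, add_comm]
    have h01 : negAt (n := n) 0 * negAt 1 ∈ C := by
      rw [negAt_zero_mul_negAt_one, pow_two, ← mul_assoc]
      exact C.mul_mem m2 m1
    rw [h]
    exact C.mul_mem (C.mul_mem (mr i) h01) (C.inv_mem (mr i))
  have mnegAt0 (k : ℕ) : negAt (k : ZMod n) * negAt 0 ∈ C := by
    induction k with
    | zero =>
      rw [Nat.cast_zero, negAt_mul_negAt_self]
      exact C.one_mem
    | succ k ih =>
      have h : negAt ((k + 1 : ℕ) : ZMod n) * negAt 0 =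
          negAt (k : ZMod n) * negAt ((k : ZMod n) + 1) * (negAt (k : ZMod n) * negAt 0) := by
        rw [negAt_mul_negAt_comm (k : ZMod n) ((k : ZMod n) + 1), mul_assoc, ← mul_assoc (negAt (k : ZMod n)),
          negAt_mul_negAt_self, one_mul, Nat.cast_succ]
      rw [h]
      exact C.mul_mem (mnegAt _) ih
  have mpair (i : ZMod n) (u : ℤˣ) :
      (SemidirectProduct.inl (Pi.mulSingle i u * Pi.mulSingle 0 u) : Carrier n) ∈ C := by
    rcases Int.units_eq_one_or u with rfl | rfl
    · rw [Pi.mulSingle_one, Pi.mulSingle_one, mul_one, map_one]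
      exact C.one_mem
    · have h := mnegAt0 i.val
      rw [ZMod.natCast_zmod_val, negAt, negAt, ← map_mul] at h
      exact h
  apply le_antisymm
  · rw [Subgroup.closure_le]
    rintro _ ⟨i, rfl⟩
    rw [SetLike.mem_coe, MonoidHom.mem_ker]
    match i with
    | 0 => exact parity_rot _
    | 1 => exact parity_rot _
    | 2 =>
      rw [halvingGens_two, gens_two_one_two, map_mul, map_mul, parity_negAt, parity_negAt,
        gens_one, parity_rot]
      rfl
  · intro x hx
    rw [MonoidHom.mem_ker, ← SemidirectProduct.inl_left_mul_inr_right x, map_mul, parity_inl] at hx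
    have hx' : ∏ i, x.left i = 1 := by
      have := parity_rot x.right
      rw [rot] at this
      rwa [this, mul_one] at hx
    rw [← SemidirectProduct.inl_left_mul_inr_right x]
    refine C.mul_mem ?_ (mrot _)
    have hl : x.left = ∏ i, (Pi.mulSingle i (x.left i) * Pi.mulSingle 0 (x.left i)) := by
      rw [Finset.prod_mul_distrib, Finset.univ_prod_mulSingle]
      have h0 : ∏ i, (Pi.mulSingle 0 (x.left i) : ZMod n → ℤˣ) = 1 := by
        refine (map_prod (MonoidHom.mulSingle (fun _ : ZMod n => ℤˣ) 0) _ _).symm.trans ?_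
        rw [hx', map_one]
      rw [h0, mul_one]
    rw [hl]
    refine Finset.prod_induction _ (fun f => (SemidirectProduct.inl f : Carrier n) ∈ C) ?_ ?_
      fun i _ => mpair i (x.left i)
    · intro f g hf hg
      rw [map_mul]
      exact C.mul_mem hf hg
    · rw [map_one]
      exact C.one_mem

theorem card_closure_halvingGens :
    Nat.card (Subgroup.closure (Set.range (halvingGens 3 (gens n)))) = 2 ^ n * n := by
  rw [closure_halvingGens]
  have h1 := Subgroup.card_mul_index (parity n).ker
  have h2 : (parity n).range = ⊤ := by
    rw [eq_top_iff]
    intro u _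
    rcases Int.units_eq_one_or u with rfl | rfl
    · exact one_mem _
    · exact ⟨negAt 0, parity_negAt 0⟩
  rw [Subgroup.index_ker, h2, Subgroup.card_top, SemidirectProduct.card, DihedralGroup.nat_card,
    Nat.card_fun, Nat.card_zmod, Nat.card_eq_fintype_card (α := ℤˣ), Fintype.card_units_int] at h1
  linarith

end

theorem isHalvableGens (hn : 3 ≤ n) : IsHalvableGens (gens n) n :=
  haveI : NeZero n := ⟨by omega⟩
  haveI : Fact (1 < n) := ⟨by omega⟩
  { three_le := hn
    mul_self := gens_mul_self
    comm := gens_comm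
    orderOf_zero_one := orderOf_gens_zero_one
    orderOf_one_two := orderOf_gens_one_two
    inf_le := gens_inf_le
    card_eq := card_closure_halvingGens }

end SignedDihedral

namespace SignedDihedral

variable {n : ℕ}

/-- The action of signed permutations on sign vectors. -/
def signAct (n : ℕ) : Carrier n →* Equiv.Perm (ZMod n → ℤˣ) :=
  SemidirectProduct.lift (MulAction.toPermHom _ _) (MulAut.toPerm _ |>.comp mulAutArrow) (by
    intro g
    refine MonoidHom.ext fun f => Equiv.ext fun s => ?_
    change mulAutArrow g f * s = mulAutArrow g (f * (mulAutArrow g).symm s)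
    rw [map_mul, MulEquiv.apply_symm_apply])

theorem signAct_apply (w : Carrier n) (s : ZMod n → ℤˣ) :
    signAct n w s = w.left * mulAutArrow w.right s := rfl

theorem signAct_apply_smul (w : Carrier n) (s : ZMod n → ℤˣ) (i : ZMod n) :
    signAct n w s (w.right • i) = w.left (w.right • i) * s i := by
  rw [signAct_apply, Pi.mul_apply, mulAutArrow_apply_apply]
  change _ * s (w.right⁻¹ • w.right • i) = _
  rw [inv_smul_smul]

theorem signAct_rot_one (g : DihedralGroup n) : signAct n (rot g) 1 = 1 := by
  rw [signAct_apply, map_one]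
  rfl

theorem signAct_negAt (i : ZMod n) (s : ZMod n → ℤˣ) :
    signAct n (negAt i) s = Pi.mulSingle i (-1) * s := by
  rw [signAct_apply, negAt, SemidirectProduct.right_inl, map_one]
  rfl

theorem eq_one_of_forall_smul_eq (hn : 3 ≤ n) {g : DihedralGroup n}
    (h : ∀ k : ZMod n, g • k = k) : g = 1 := by
  match g with
  | .r i =>
    have h0 := h 0
    rw [r_smul, zero_add] at h0
    rw [h0]
    rfl
  | .sr i =>
    have h0 := h 0
    have h1 := h 1
    rw [sr_smul, zero_add, neg_eq_zero] at h0
    rw [sr_smul, h0, add_zero, neg_eq_iff_add_eq_zero] at h1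
    have h2 : ((2 : ℕ) : ZMod n) = 0 := by
      rw [← h1]
      norm_num
    have := Nat.le_of_dvd two_pos ((ZMod.natCast_eq_zero_iff 2 n).1 h2)
    omega

theorem signAct_injective (hn : 3 ≤ n) : Function.Injective (signAct n) := by
  rw [injective_iff_map_eq_one]
  intro w hw
  have hs (s : ZMod n → ℤˣ) : w.left * mulAutArrow w.right s = s := by
    rw [← signAct_apply, hw, Equiv.Perm.one_apply]
  have hl : w.left = 1 := by
    have := hs 1
    rwa [map_one, mul_one] at this
  refine SemidirectProduct.ext hl (eq_one_of_forall_smul_eq hn fun k => ?_)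
  have h := hs (Pi.mulSingle k (-1))
  rw [hl, one_mul, mulAutArrow_mulSingle] at h
  have h1 := congrFun h k
  by_contra hk
  rw [Pi.mulSingle_eq_same, Pi.mulSingle_eq_of_ne (Ne.symm hk)] at h1
  exact absurd h1 (by decide)

end SignedDihedral

/-- A choice of sign for one of two states. -/
def boolEquivSign (b : Bool) : Bool ≃ ℤˣ where
  toFun c := if c = b then 1 else -1
  invFun u := if u = 1 then b else !b
  left_inv c := by revert b c; decide
  right_inv u := by revert b u; decide

namespace genCube

variable {L : Type*} [PartialOrder L] {rk : L → ℤ}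

/-- The automorphism of (the dual of) a generalised cube induced by a permutation of the points. -/
def permAut {W : Type*} [Group W] (a : W →* Equiv.Perm (polyVertices L rk → Bool))
    (h : ∀ w F x, ∃ F', a w '' cubeFace L rk F x = cubeFace L rk F' (a w x)) :
    W →* orderAut (genCube L rk)ᵒᵈ :=
  have h' (w : W) (S : genCube L rk) :
      a w '' S.1 = ∅ ∨ ∃ F x, a w '' S.1 = cubeFace L rk F x := by
    obtain ⟨S, rfl | ⟨F, x, rfl⟩⟩ := S
    · exact Or.inl (Set.image_empty _)
    · obtain ⟨F', hF'⟩ := h w F x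
      exact Or.inr ⟨F', _, hF'⟩
  let b : W →* Equiv.Perm (genCube L rk)ᵒᵈ := MonoidHom.toHomPerm
    { toFun := fun w S => OrderDual.toDual ⟨a w '' (OrderDual.ofDual S).1, h' w _⟩
      map_one' := by
        funext S
        refine Subtype.ext ?_
        change a 1 '' _ = _
        rw [map_one]
        exact Set.image_id _
      map_mul' := by
        intro v w
        funext S
        refine Subtype.ext ?_
        change a (v * w) '' _ = a v '' (a w '' _)
        rw [map_mul, Equiv.Perm.coe_mul, Set.image_comp] }
  b.codRestrict _ fun w S T => Set.image_subset_image_iff (a w).injective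

end genCube

/-! ### Cyclic labellings -/

/-- The faces of a polytope `L` of rank 2 labelled as those of a `p`-gon. -/
structure CyclicLabelling (L : Type*) [PartialOrder L] (rk : L → ℤ) (p : ℕ) where
  isPolytope : IsPolytope L rk 2
  three_le : 3 ≤ p
  vert : ZMod p → L
  side : ZMod p → L
  vert_injective : Function.Injective vert
  rk_eq_zero_iff : ∀ F, rk F = 0 ↔ ∃ i, F = vert i
  rk_eq_one_iff : ∀ F, rk F = 1 ↔ ∃ i, F = side i
  vert_le_side : ∀ i j, vert i ≤ side j ↔ i = j ∨ i = j + 1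

namespace CyclicLabelling

variable {L : Type*} [PartialOrder L] {rk : L → ℤ} {p : ℕ} (c : CyclicLabelling L rk p)
include c

theorem rk_vert (i : ZMod p) : rk (c.vert i) = 0 := (c.rk_eq_zero_iff _).2 ⟨i, rfl⟩

theorem rk_side (i : ZMod p) : rk (c.side i) = 1 := (c.rk_eq_one_iff _).2 ⟨i, rfl⟩

theorem one_ne_zero : (1 : ZMod p) ≠ 0 := fun h => by
  have := Nat.le_of_dvd one_pos ((ZMod.natCast_eq_zero_iff 1 p).1 (by exact_mod_cast h))
  have := c.three_le
  omega

theorem two_ne_zero : (1 + 1 : ZMod p) ≠ 0 := fun h => by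
  have := Nat.le_of_dvd two_pos ((ZMod.natCast_eq_zero_iff 2 p).1 (by
    rw [← h]
    norm_num))
  have := c.three_le
  omega

theorem vert_le_vert (i j : ZMod p) : c.vert i ≤ c.vert j ↔ i = j := by
  refine ⟨fun h => c.vert_injective (h.eq_of_not_lt fun h1 => ?_), fun h => h ▸ le_rfl⟩
  have := c.isPolytope.rk_strictMono h1
  rw [c.rk_vert, c.rk_vert] at this
  exact lt_irrefl _ this

theorem not_vert_le {b : L} (hb : rk b = -1) (i : ZMod p) : ¬ c.vert i ≤ b := fun h => by
  have := c.isPolytope.rk_strictMono.monotone h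
  rw [c.rk_vert, hb] at this
  omega

theorem eq_of_side_subset {i j : ZMod p} (h0 : i = j ∨ i = j + 1)
    (h1 : i + 1 = j ∨ i + 1 = j + 1) : i = j := by
  rcases h0 with h0 | h0
  · exact h0
  · rcases h1 with h1 | h1
    · exact absurd (by linear_combination h1 - h0) c.two_ne_zero
    · exact add_right_cancel h1

theorem side_injective : Function.Injective c.side := fun i j h => by
  have h0 := (c.vert_le_side i i).2 (Or.inl rfl)
  have h1 := (c.vert_le_side (i + 1) i).2 (Or.inr rfl)
  rw [h, c.vert_le_side] at h0 h1
  exact c.eq_of_side_subset h0 h1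

theorem cases (F : L) : (IsBot F ∧ rk F = -1) ∨ (∃ i, F = c.vert i) ∨ (∃ i, F = c.side i) ∨
    (IsTop F ∧ rk F = 2) := by
  have h1 := c.isPolytope.neg_one_le F
  have h2 := c.isPolytope.rk_le F
  have h : rk F = -1 ∨ rk F = 0 ∨ rk F = 1 ∨ rk F = 2 := by
    push_cast at h2
    omega
  rw [c.rk_eq_zero_iff, c.rk_eq_one_iff] at h
  refine h.imp (fun h => ⟨c.isPolytope.isBot_of_rk h, h⟩) (Or.imp_right (Or.imp_right fun h => ?_))
  exact ⟨c.isPolytope.isTop_of_rk h, h⟩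

theorem vertexDescribable : VertexDescribable L rk := by
  intro F G h
  have hv (i : ZMod p) : c.vert i ≤ F → c.vert i ≤ G := h ⟨c.vert i, c.rk_vert i⟩
  rcases c.cases F with hF | ⟨i, rfl⟩ | ⟨i, rfl⟩ | hF
  · exact hF.1 G
  · exact hv i le_rfl
  · have h0 := hv i ((c.vert_le_side i i).2 (Or.inl rfl))
    have h1 := hv (i + 1) ((c.vert_le_side (i + 1) i).2 (Or.inr rfl))
    rcases c.cases G with hG | ⟨j, rfl⟩ | ⟨j, rfl⟩ | hG
    · exact absurd h0 (c.not_vert_le hG.2 i)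
    · rw [c.vert_le_vert] at h0 h1
      exact absurd (by linear_combination h1 - h0) c.one_ne_zero
    · rw [c.vert_le_side] at h0 h1
      rw [c.eq_of_side_subset h0 h1]
    · exact hG.1 _
  · have hv' (i : ZMod p) : c.vert i ≤ G := hv i (hF.1 _)
    rcases c.cases G with hG | ⟨j, rfl⟩ | ⟨j, rfl⟩ | hG
    · exact absurd (hv' 0) (c.not_vert_le hG.2 0)
    · have h1 := (c.vert_le_vert _ _).1 (hv' (j + 1))
      exact absurd (by linear_combination h1) c.one_ne_zero
    · rcases (c.vert_le_side _ _).1 (hv' (j + 1 + 1)) with h1 | h1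
      · exact absurd (by linear_combination h1) c.two_ne_zero
      · exact absurd (by linear_combination h1) c.one_ne_zero
    · exact hG.1 F

/-- The dihedral group permutes the faces. -/
theorem exists_smul (g : DihedralGroup p) (F : L) :
    ∃ F', ∀ i, c.vert (g • i) ≤ F' ↔ c.vert i ≤ F := by
  rcases c.cases F with hF | ⟨i, rfl⟩ | ⟨i, rfl⟩ | hF
  · exact ⟨F, fun j => iff_of_false (c.not_vert_le hF.2 _) (c.not_vert_le hF.2 _)⟩
  · exact ⟨c.vert (g • i), fun j => by rw [c.vert_le_vert, c.vert_le_vert, smul_left_cancel_iff]⟩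
  · match g with
    | .r t =>
      refine ⟨c.side (i + t), fun j => ?_⟩
      rw [c.vert_le_side, c.vert_le_side, SignedDihedral.r_smul, add_right_cancel_iff,
        add_right_comm, add_right_cancel_iff]
    | .sr t =>
      refine ⟨c.side (-(i + 1 + t)), fun j => ?_⟩
      have e : -(i + 1 + t) + 1 = -(i + t) := by ring
      rw [c.vert_le_side, c.vert_le_side, SignedDihedral.sr_smul, e, neg_inj, neg_inj,
        add_right_cancel_iff, add_right_cancel_iff, or_comm]
  · exact ⟨F, fun j => iff_of_true (hF.1 _) (hF.1 _)⟩

/-- Vertices are labelled by `ℤ/p`. -/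
def vertEquiv : ZMod p ≃ polyVertices L rk :=
  Equiv.ofBijective (fun i => ⟨c.vert i, c.rk_vert i⟩)
    ⟨fun _ _ h => c.vert_injective (congrArg Subtype.val h), fun v => by
      obtain ⟨i, hi⟩ := (c.rk_eq_zero_iff v.1).1 v.2
      exact ⟨i, Subtype.ext hi.symm⟩⟩

theorem coe_vertEquiv (i : ZMod p) : (c.vertEquiv i).1 = c.vert i := rfl

/-- Points as sign vectors, relative to a base point. -/
def signs (x₀ : polyVertices L rk → Bool) : (polyVertices L rk → Bool) ≃ (ZMod p → ℤˣ) :=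
  (Equiv.arrowCongr c.vertEquiv.symm (Equiv.refl Bool)).trans
    (Equiv.piCongrRight fun i => boolEquivSign (x₀ (c.vertEquiv i)))

theorem signs_apply (x₀ y : polyVertices L rk → Bool) (i : ZMod p) :
    c.signs x₀ y i = boolEquivSign (x₀ (c.vertEquiv i)) (y (c.vertEquiv i)) := rfl

theorem signs_apply_eq_iff {x₀ y z : polyVertices L rk → Bool} {i : ZMod p} :
    c.signs x₀ y i = c.signs x₀ z i ↔ y (c.vertEquiv i) = z (c.vertEquiv i) := by
  rw [signs_apply, signs_apply, EmbeddingLike.apply_eq_iff_eq]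

theorem signs_self (x₀ : polyVertices L rk → Bool) : c.signs x₀ x₀ = 1 := by
  funext i
  exact if_pos rfl

theorem mem_cubeFace_iff (x₀ : polyVertices L rk → Bool) {F : L} {x y : polyVertices L rk → Bool} :
    y ∈ cubeFace L rk F x ↔ ∀ i, ¬ c.vert i ≤ F → c.signs x₀ y i = c.signs x₀ x i := by
  rw [genCube.mem_cubeFace, ← c.vertEquiv.forall_congr_right]
  simp only [c.signs_apply_eq_iff, c.coe_vertEquiv]

/-- The action of signed permutations on points. -/
def act (x₀ : polyVertices L rk → Bool) :
    SignedDihedral.Carrier p →* Equiv.Perm (polyVertices L rk → Bool) :=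
  (c.signs x₀).symm.permCongrHom.toMonoidHom.comp (SignedDihedral.signAct p)

theorem signs_act (x₀ : polyVertices L rk → Bool) (w : SignedDihedral.Carrier p)
    (x : polyVertices L rk → Bool) :
    c.signs x₀ (c.act x₀ w x) = SignedDihedral.signAct p w (c.signs x₀ x) :=
  (c.signs x₀).apply_symm_apply _

theorem act_injective (x₀ : polyVertices L rk → Bool) : Function.Injective (c.act x₀) :=
  ((c.signs x₀).symm.permCongrHom.injective).comp (SignedDihedral.signAct_injective c.three_le)

theorem act_image_cubeFace (x₀ : polyVertices L rk → Bool) (w : SignedDihedral.Carrier p)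
    {F F' : L} (hF : ∀ i, c.vert (w.right • i) ≤ F' ↔ c.vert i ≤ F)
    (x : polyVertices L rk → Bool) :
    c.act x₀ w '' cubeFace L rk F x = cubeFace L rk F' (c.act x₀ w x) := by
  ext y
  rw [← (c.act x₀ w).apply_symm_apply y, (c.act x₀ w).injective.mem_set_image,
    c.mem_cubeFace_iff x₀, c.mem_cubeFace_iff x₀]
  refine Iff.trans (forall_congr' fun i => ?_) (MulAction.toPerm w.right).forall_congr_right
  rw [MulAction.toPerm_apply, hF, c.signs_act, c.signs_act, SignedDihedral.signAct_apply_smul,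
    SignedDihedral.signAct_apply_smul, mul_right_inj]

/-- The action of signed permutations on the dual of the generalised cube. -/
def aut (x₀ : polyVertices L rk → Bool) :
    SignedDihedral.Carrier p →* orderAut (genCube L rk)ᵒᵈ :=
  genCube.permAut (c.act x₀) fun w F x => by
    obtain ⟨F', hF'⟩ := c.exists_smul w.right F
    exact ⟨F', c.act_image_cubeFace x₀ w hF' x⟩

theorem aut_mk (x₀ : polyVertices L rk → Bool) (w : SignedDihedral.Carrier p)
    {F F' : L} (hF : ∀ i, c.vert (w.right • i) ≤ F' ↔ c.vert i ≤ F)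
    (x : polyVertices L rk → Bool) :
    (c.aut x₀ w).1 (OrderDual.toDual (genCube.mk F x)) =
      OrderDual.toDual (genCube.mk F' (c.act x₀ w x)) :=
  Subtype.ext (c.act_image_cubeFace x₀ w hF x)

theorem aut_empty (x₀ : polyVertices L rk → Bool) (w : SignedDihedral.Carrier p) :
    (c.aut x₀ w).1 (OrderDual.toDual genCube.empty) = OrderDual.toDual genCube.empty :=
  Subtype.ext (Set.image_empty _)

theorem aut_injective (x₀ : polyVertices L rk → Bool) : Function.Injective (c.aut x₀) := by
  rw [injective_iff_map_eq_one]
  intro w hw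
  refine (injective_iff_map_eq_one (c.act x₀)).1 (c.act_injective x₀) w (Equiv.ext fun x => ?_)
  obtain ⟨b, -, hb⟩ := c.isPolytope.1
  obtain ⟨F', hF'⟩ := c.exists_smul w.right b
  have h := c.aut_mk x₀ w hF' x
  rw [hw] at h
  have h' := (genCube.mk_eq_mk c.vertexDescribable).1 (OrderDual.toDual.injective h.symm)
  exact (genCube.mem_cubeFace_of_isBot c.isPolytope hb).1 h'.2

end CyclicLabelling

theorem IsPolytope.isDistinguishedGens {P : Type*} [PartialOrder P] {rk : P → ℤ} {n : ℕ}
    (h : IsPolytope P rk n) {Φ : Set P} (hΦ : IsMaxFlag P Φ) {ϱ : Fin n → ↥(orderAut P)}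
    (hmove : ∀ i, ∃ x ∈ Φ, (ϱ i).1 x ≠ x)
    (hfix : ∀ i : Fin n, ∀ x ∈ Φ, rk x ≠ ((i : ℕ) : ℤ) → (ϱ i).1 x = x) :
    IsDistinguishedGens P rk n Φ ϱ := by
  refine ⟨hΦ, fun i => ⟨fun he => ?_, fun x hx hxi => ⟨x, hx, hfix i x hx hxi⟩⟩⟩
  obtain ⟨x, hx, hne⟩ := hmove i
  exact hne (h.apply_eq_of_image_eq (ϱ i).2 hΦ he hx)

namespace CyclicLabelling

open SignedDihedral genCube

variable {L : Type*} [PartialOrder L] {rk : L → ℤ} {p : ℕ} (c : CyclicLabelling L rk p)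
include c

theorem act_rot_self (x₀ : polyVertices L rk → Bool) (g : DihedralGroup p) :
    c.act x₀ (rot g) x₀ = x₀ := by
  apply (c.signs x₀).injective
  rw [c.signs_act, c.signs_self, signAct_rot_one]

theorem act_negAt_self_mem_iff (x₀ : polyVertices L rk → Bool) (F : L) :
    c.act x₀ (negAt 0) x₀ ∈ cubeFace L rk F x₀ ↔ c.vert 0 ≤ F := by
  rw [c.mem_cubeFace_iff x₀, c.signs_act, c.signs_self, signAct_negAt, mul_one]
  constructor
  · intro h
    by_contra h0
    have h1 := h 0 h0
    rw [Pi.mulSingle_eq_same, Pi.one_apply] at h1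
    exact absurd h1 (by decide)
  · intro h i hi
    rw [Pi.mulSingle_eq_of_ne, Pi.one_apply]
    rintro rfl
    exact hi h

theorem aut_rot_mk (x₀ : polyVertices L rk → Bool) {g : DihedralGroup p} {F F' : L}
    (hF : ∀ i, c.vert (g • i) ≤ F' ↔ c.vert i ≤ F) :
    (c.aut x₀ (rot g)).1 (OrderDual.toDual (genCube.mk F x₀)) = OrderDual.toDual (genCube.mk F' x₀) := by
  rw [c.aut_mk x₀ (rot g) hF, c.act_rot_self]

theorem aut_negAt_mk (x₀ : polyVertices L rk → Bool) (F : L) :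
    (c.aut x₀ (negAt 0)).1 (OrderDual.toDual (genCube.mk F x₀)) = OrderDual.toDual (genCube.mk F x₀) ↔
      c.vert 0 ≤ F := by
  rw [c.aut_mk x₀ (negAt 0) (F' := F) (fun i => by rw [negAt, SemidirectProduct.right_inl, one_smul]),
    EmbeddingLike.apply_eq_iff_eq, mk_eq_mk c.vertexDescribable, and_iff_right rfl,
    c.act_negAt_self_mem_iff]

/-- The standard signed permutations are the distinguished generators of the dual of the
generalised cube. -/
theorem isDistinguishedGens [Finite L] (x₀ : polyVertices L rk → Bool) {Φ : Set L}
    (hΦ : IsMaxFlag L Φ) (hv : c.vert 0 ∈ Φ) (hs : c.side 0 ∈ Φ) :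
    IsDistinguishedGens (genCube L rk)ᵒᵈ (dualRk rank 3) 3 (flag x₀ Φ)
      (fun i => c.aut x₀ (gens p i)) := by
  have hD := c.vertexDescribable
  have hrk (F : L) : dualRk rank 3 (OrderDual.toDual (genCube.mk F x₀)) = 1 - rk F := by
    change (3 : ℕ) - 1 - rank (genCube.mk F x₀) = _
    rw [rank_mk hD]
    push_cast
    ring
  have hmem {F : L} (hF : F ∈ Φ) : OrderDual.toDual (genCube.mk F x₀) ∈ flag x₀ Φ := (mk_mem_flag hD).2 hF
  have hbot {F : L} (h : rk F = -1) (g : DihedralGroup p) (i : ZMod p) :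
      c.vert (g • i) ≤ F ↔ c.vert i ≤ F := iff_of_false (c.not_vert_le h _) (c.not_vert_le h _)
  have htop {F : L} (h : IsTop F) (g : DihedralGroup p) (i : ZMod p) :
      c.vert (g • i) ≤ F ↔ c.vert i ≤ F := iff_of_true (h _) (h _)
  have v0 (i : ZMod p) : c.vert (DihedralGroup.sr (0 : ZMod p) • i) ≤ c.vert 0 ↔ c.vert i ≤ c.vert 0 := by
    rw [c.vert_le_vert, c.vert_le_vert, sr_smul, add_zero, neg_eq_zero]
  have s0 (i : ZMod p) : c.vert (DihedralGroup.sr (0 : ZMod p) • i) ≤ c.side (-1) ↔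
      c.vert i ≤ c.side 0 := by
    rw [c.vert_le_side, c.vert_le_side, sr_smul, add_zero, neg_inj, neg_add_cancel, neg_eq_zero,
      zero_add, or_comm]
  have v1 (i : ZMod p) : c.vert (DihedralGroup.sr (-1 : ZMod p) • i) ≤ c.vert 1 ↔
      c.vert i ≤ c.vert 0 := by
    rw [c.vert_le_vert, c.vert_le_vert, sr_smul, ← neg_inj, neg_neg, add_eq_right]
  have s1 (i : ZMod p) : c.vert (DihedralGroup.sr (-1 : ZMod p) • i) ≤ c.side 0 ↔ c.vert i ≤ c.side 0 := by
    have e : -(i + -1) = 0 + 1 ↔ i = 0 :=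
      ⟨fun h => by linear_combination -h, fun h => by rw [h]; ring⟩
    have e' : -(i + -1) = 0 ↔ i = 0 + 1 :=
      ⟨fun h => by linear_combination -h, fun h => by rw [h]; ring⟩
    rw [c.vert_le_side, c.vert_le_side, sr_smul, e, e', or_comm]
  refine (genCube.isPolytope c.isPolytope hD).orderDual.isDistinguishedGens
    (isMaxFlag_orderDual.2 (isMaxFlag_flag c.isPolytope hD hΦ)) ?_ ?_
  · intro i
    match i with
    | 0 =>
      refine ⟨_, hmem hs, fun h => c.one_ne_zero ?_⟩
      rw [gens_zero, c.aut_rot_mk x₀ s0, EmbeddingLike.apply_eq_iff_eq, mk_eq_mk hD] at h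
      exact neg_eq_zero.1 (c.side_injective h.1)
    | 1 =>
      refine ⟨_, hmem hv, fun h => c.one_ne_zero ?_⟩
      rw [gens_one, c.aut_rot_mk x₀ v1, EmbeddingLike.apply_eq_iff_eq, mk_eq_mk hD] at h
      exact c.vert_injective h.1
    | 2 =>
      obtain ⟨b, hb, hb'⟩ := c.isPolytope.exists_mem hΦ (k := -1) le_rfl (by norm_num)
      refine ⟨_, hmem hb, fun h => ?_⟩
      rw [gens_two, c.aut_negAt_mk] at h
      exact c.not_vert_le hb' 0 h
  · rintro i _ (rfl | ⟨F, hF, rfl⟩)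
    · exact fun _ => c.aut_empty x₀ _
    · intro hi
      change dualRk rank 3 (OrderDual.toDual (genCube.mk F x₀)) ≠ _ at hi
      change (c.aut x₀ (gens p i)).1 (OrderDual.toDual (genCube.mk F x₀)) = OrderDual.toDual (genCube.mk F x₀)
      rw [hrk] at hi
      have hvF {j : ZMod p} (h : F = c.vert j) : F = c.vert 0 :=
        c.isPolytope.eq_of_rk_eq hΦ hF hv (by rw [h, c.rk_vert, c.rk_vert])
      have hsF {j : ZMod p} (h : F = c.side j) : F = c.side 0 :=
        c.isPolytope.eq_of_rk_eq hΦ hF hs (by rw [h, c.rk_side, c.rk_side])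
      rcases c.cases F with h | ⟨j, h⟩ | ⟨j, h⟩ | h
      · match i with
        | 0 => exact c.aut_rot_mk x₀ (hbot h.2 _)
        | 1 => exact c.aut_rot_mk x₀ (hbot h.2 _)
        | 2 => exact absurd (by rw [h.2]; rfl) hi
      · rw [hvF h] at hi ⊢
        match i with
        | 0 => exact c.aut_rot_mk x₀ v0
        | 1 => exact absurd (by rw [c.rk_vert]; rfl) hi
        | 2 => exact (c.aut_negAt_mk x₀ _).2 le_rfl
      · rw [hsF h] at hi ⊢
        match i with
        | 0 => exact absurd (by rw [c.rk_side]; rfl) hi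
        | 1 => exact c.aut_rot_mk x₀ s1
        | 2 => exact (c.aut_negAt_mk x₀ _).2 ((c.vert_le_side 0 0).2 (Or.inl rfl))
      · match i with
        | 0 => exact c.aut_rot_mk x₀ (htop h.1 _)
        | 1 => exact c.aut_rot_mk x₀ (htop h.1 _)
        | 2 => exact (c.aut_negAt_mk x₀ _).2 (h.1 _)

end CyclicLabelling

namespace CyclicLabelling

open genCube

section

variable {L : Type*} [PartialOrder L] {rk : L → ℤ} {p : ℕ} (c : CyclicLabelling L rk p)
include c

theorem nonDegenerate : NonDegenerate (genCube L rk)ᵒᵈ (dualRk rank 3) := by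
  have hD := c.vertexDescribable
  suffices H : ∀ S T : genCube L rk, S < T → rank T = rank S + 3 → ∃ H₁ H₂ H₃ : genCube L rk,
      (S < H₁ ∧ H₁ < T ∧ rank H₁ = rank T - 1) ∧ (S < H₂ ∧ H₂ < T ∧ rank H₂ = rank T - 1) ∧
      (S < H₃ ∧ H₃ < T ∧ rank H₃ = rank T - 1) ∧ H₁ ≠ H₂ ∧ H₁ ≠ H₃ ∧ H₂ ≠ H₃ by
    intro T S hST hr
    have hd (U : genCube L rk) : dualRk rank 3 (OrderDual.toDual U) = 2 - rank U := by
      change (3 : ℕ) - 1 - rank U = _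
      push_cast
      ring
    have hr' : 2 - rank (OrderDual.ofDual S) = 2 - rank (OrderDual.ofDual T) + 3 := hr
    obtain ⟨H₁, H₂, H₃, h₁, h₂, h₃, h₁₂, h₁₃, h₂₃⟩ :=
      H (OrderDual.ofDual S) (OrderDual.ofDual T) hST (by omega)
    have hH {U : genCube L rk} (hU : OrderDual.ofDual S < U ∧ U < OrderDual.ofDual T ∧
        rank U = rank (OrderDual.ofDual T) - 1) : T < OrderDual.toDual U ∧ OrderDual.toDual U < S ∧
          dualRk rank 3 (OrderDual.toDual U) = dualRk rank 3 T + 1 := by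
      refine ⟨hU.2.1, hU.1, ?_⟩
      rw [hd, hU.2.2]
      change _ = 2 - rank (OrderDual.ofDual T) + 1
      ring
    exact ⟨_, _, _, hH h₁, hH h₂, hH h₃, h₁₂, h₁₃, h₂₃⟩
  intro S T hST hr
  rcases eq_empty_or_eq_mk T with rfl | ⟨F, x, rfl⟩
  · exact absurd hST (isBot_empty S).not_gt
  rw [rank_mk hD] at hr ⊢
  have hF := c.isPolytope.rk_le F
  rcases eq_empty_or_eq_mk S with rfl | ⟨E, y, rfl⟩
  · rw [rank_empty] at hr
    obtain ⟨j, rfl⟩ := (c.rk_eq_one_iff F).1 (by omega)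
    have hj : j ≠ j + 1 := fun h => c.one_ne_zero (add_eq_left.1 h.symm)
    have hlt {i : ZMod p} (h : c.vert i ≤ c.side j) : c.vert i < c.side j := by
      refine lt_of_le_of_ne h fun e => ?_
      have := c.rk_vert i
      rw [e, c.rk_side] at this
      omega
    have h0 := hlt ((c.vert_le_side j j).2 (Or.inl rfl))
    have h1 := hlt ((c.vert_le_side (j + 1) j).2 (Or.inr rfl))
    classical
    let x' : polyVertices L rk → Bool :=
      Function.update x (c.vertEquiv (j + 1)) (!x (c.vertEquiv (j + 1)))
    have hx' : x' ∈ cubeFace L rk (c.side j) x := fun v hv => by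
      refine Function.update_of_ne ?_ _ _
      rintro rfl
      exact hv h1.le
    have hr (i : ZMod p) (z : polyVertices L rk → Bool) :
        rank (genCube.mk (c.vert i) z) = rk (c.side j) + 1 - 1 := by
      rw [rank_mk hD, c.rk_vert, c.rk_side]
      norm_num
    refine ⟨genCube.mk (c.vert j) x, genCube.mk (c.vert (j + 1)) x, genCube.mk (c.vert j) x',
      ⟨empty_lt_mk _ _, (mk_lt_mk_self hD).2 h0, hr _ _⟩,
      ⟨empty_lt_mk _ _, (mk_lt_mk_self hD).2 h1, hr _ _⟩,
      ⟨empty_lt_mk _ _, (mk_lt_mk hD).2 ⟨h0, hx'⟩, hr _ _⟩, fun e => ?_, fun e => ?_, fun e => ?_⟩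
    · exact hj (c.vert_injective ((mk_eq_mk hD).1 e).1)
    · have h2 := ((mk_eq_mk hD).1 e).2 (c.vertEquiv (j + 1))
        (fun h => hj ((c.vert_le_vert _ _).1 h).symm)
      exact (Bool.eq_not_self _).1 (h2.trans (Function.update_self _ _ _))
    · exact hj (c.vert_injective ((mk_eq_mk hD).1 e).1).symm
  · rw [rank_mk hD] at hr
    have hE := c.isPolytope.neg_one_le E
    push_cast at hF
    have hEb : rk E = -1 := by omega
    have hFt : rk F = (2 : ℕ) := by push_cast; omega
    have hlt (i : ZMod p) : genCube.mk E y < genCube.mk (c.side i) y ∧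
        genCube.mk (c.side i) y < genCube.mk F x ∧
        rank (genCube.mk (c.side i) y) = rk F + 1 - 1 := by
      refine ⟨(mk_lt_mk_self hD).2 (lt_of_le_of_ne (c.isPolytope.isBot_of_rk hEb _) ?_),
        (mk_lt_mk hD).2 ⟨lt_of_le_of_ne (c.isPolytope.isTop_of_rk hFt _) ?_,
          ((mk_lt_mk hD).1 hST).2⟩, ?_⟩
      · rintro rfl
        rw [c.rk_side] at hEb
        omega
      · rintro rfl
        rw [c.rk_side] at hFt
        norm_num at hFt
      · rw [rank_mk hD, c.rk_side, hFt]
        norm_num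
    have hne {i j : ZMod p} (h : i ≠ j) : genCube.mk (c.side i) y ≠ genCube.mk (c.side j) y :=
      fun e => h (c.side_injective ((mk_eq_mk hD).1 e).1)
    exact ⟨_, _, _, hlt 0, hlt 1, hlt (1 + 1), hne c.one_ne_zero.symm, hne c.two_ne_zero.symm,
      hne fun h => c.one_ne_zero (add_eq_left.1 h.symm)⟩

end

variable {K : Type*} [PartialOrder K] {rk : K → ℤ} {p : ℕ}

theorem exists_of_isPolytope [Finite K] (hK : IsPolytope K rk 2) (hp : 3 ≤ p)
    (hvert : Nat.card (polyVertices K rk) = p) {Φ : Set Kᵒᵈ} (hΦ : IsMaxFlag Kᵒᵈ Φ) :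
    ∃ c : CyclicLabelling Kᵒᵈ (dualRk rk 2) p, c.vert 0 ∈ Φ ∧ c.side 0 ∈ Φ := by
  have hΦ' : IsMaxFlag K (OrderDual.toDual ⁻¹' Φ) := isMaxFlag_orderDual.1 hΦ
  obtain ⟨v, hv, hv'⟩ := hK.exists_mem hΦ' (k := 0) (by norm_num) (by norm_num)
  obtain ⟨e, he, he'⟩ := hK.exists_mem hΦ' (k := 1) (by norm_num) (by norm_num)
  have hve' : v < e := hK.lt_of_rk_lt hΦ' hv he (by omega)
  obtain ⟨vert, edge, hv0, he0, hvi, hei, hvr, her, hve⟩ := exists_polygon_labelling hK hvert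
    ⟨(v, e), hv', he', hve'⟩
  have hd (F : Kᵒᵈ) : dualRk rk 2 F = 1 - rk (OrderDual.ofDual F) := by
    change (2 : ℕ) - 1 - rk (OrderDual.ofDual F) = _
    norm_num
  refine ⟨{
    isPolytope := hK.orderDual
    three_le := hp
    vert := fun i => OrderDual.toDual (edge i)
    side := fun i => OrderDual.toDual (vert i)
    vert_injective := hei
    rk_eq_zero_iff := fun F => ?_
    rk_eq_one_iff := fun F => ?_
    vert_le_side := fun i j => hve j i }, ?_, ?_⟩
  · rw [hd, sub_eq_zero, eq_comm]
    exact her _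
  · rw [hd, sub_eq_self]
    exact hvr _
  · change OrderDual.toDual (edge 0) ∈ Φ
    rw [he0]
    exact he
  · change OrderDual.toDual (vert 0) ∈ Φ
    rw [hv0]
    exact hv

end CyclicLabelling

/-- Every flag of `D2{p}` has distinguished generators, and these are halvable. -/
theorem exists_isDistinguishedGens_D2 {K : Type*} [PartialOrder K] {rk : K → ℤ} {p : ℕ} [Finite K]
    (hK : IsPolytope K rk 2) (hp : 3 ≤ p) (hvert : Nat.card (polyVertices K rk) = p)
    {ΦD : Set (D2 K rk 2)} (hΦD : IsMaxFlag (D2 K rk 2) ΦD) :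
    ∃ ϱ : Fin 3 → ↥(orderAut (D2 K rk 2)),
      IsDistinguishedGens (D2 K rk 2) (dualRk genCube.rank 3) 3 ΦD ϱ ∧ IsHalvableGens ϱ p := by
  obtain ⟨F, hF, -⟩ := exists_isMaxFlag_mem (P := Kᵒᵈ) (OrderDual.toDual hK.1.choose)
  obtain ⟨c₀, -⟩ := CyclicLabelling.exists_of_isPolytope hK hp hvert hF
  obtain ⟨x₀, Φ, hΦ, rfl⟩ := genCube.exists_eq_flag c₀.vertexDescribable
    (isMaxFlag_orderDual.1 hΦD)
  obtain ⟨c, hv, hs⟩ := CyclicLabelling.exists_of_isPolytope hK hp hvert hΦ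
  exact ⟨_, c.isDistinguishedGens x₀ hΦ hv hs,
    (SignedDihedral.isHalvableGens hp).map (c.aut_injective x₀)⟩

/-- for `p ≥ 3` and `K` the `p`-gon, the polytope
`D2{p} = (2^{{p}*})*` is a regular polyhedron of type `{p, 4}` (whose 2-faces
are `p`-gons), and the regular hypertope obtained from it by the halving
operation is a self-dual regular polyhedron of type `{p, p}` (the linear
diagram `ρ1 —p— ρ0 —p— ρ2`, the duality swapping `ρ1` and `ρ2`) with
`2^{p-1}` vertices (the type-1 elements), `2^{p-2}·p` edges (the type-0
elements) and `2^{p-1}` faces (the type-2 elements); its Euler characteristic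
is `2^{p-2}(4-p)`, which is the Euler characteristic `2 - 2g` of a surface of
genus `g = 2^{p-3}(p-4) + 1`. -/
theorem halving_D2_polygon {K : Type*} [PartialOrder K]
    (rkK : K → ℤ) (p : ℕ) (hp : 3 ≤ p) [Finite K]
    (hK : IsPolytope K rkK 2)
    (hvert : Nat.card (polyVertices K rkK) = p) :
    (∃ rkC : genCube Kᵒᵈ (dualRk rkK 2) → ℤ,
      IsPolytope (genCube Kᵒᵈ (dualRk rkK 2)) rkC 3) ∧
    ∀ rkC : genCube Kᵒᵈ (dualRk rkK 2) → ℤ,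
      IsPolytope (genCube Kᵒᵈ (dualRk rkK 2)) rkC 3 →
      -- `D2{p}` is a non-degenerate regular polyhedron of type `{p, 4}`
      IsPolytope (D2 K rkK 2) (dualRk rkC 3) 3 ∧
      NonDegenerate (D2 K rkK 2) (dualRk rkC 3) ∧
      IsRegularPolytope (D2 K rkK 2) ∧
      ∀ (ΦD : Set (D2 K rkK 2)) (ϱ : Fin 3 → ↥(orderAut (D2 K rkK 2))),
        IsDistinguishedGens (D2 K rkK 2) (dualRk rkC 3) 3 ΦD ϱ →
          orderOf (ϱ 0 * ϱ 1) = p ∧ orderOf (ϱ 1 * ϱ 2) = 4 ∧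
          -- the halving hypertope is a regular hypertope …
          (halvingCosetSystem 3 ϱ).IsRegularHypertope ∧
          -- … which is a polyhedron of type `{p, p}`: the diagram of the
          -- halving generators is the string `ρ1 —p— ρ0 —p— ρ2`
          orderOf (halvingGens 3 ϱ 0 * halvingGens 3 ϱ 1) = p ∧
          orderOf (halvingGens 3 ϱ 0 * halvingGens 3 ϱ 2) = p ∧
          orderOf (halvingGens 3 ϱ 1 * halvingGens 3 ϱ 2) = 2 ∧
          -- … self-dual: an automorphism of `H(D2{p})` swaps `ρ_1` and `ρ_2`
          (∃ σ : MulAut ↥(Subgroup.closure (Set.range (halvingGens 3 ϱ))),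
            σ (liftGens (halvingGens 3 ϱ) 0) = liftGens (halvingGens 3 ϱ) 0 ∧
            σ (liftGens (halvingGens 3 ϱ) 1) = liftGens (halvingGens 3 ϱ) 2 ∧
            σ (liftGens (halvingGens 3 ϱ) 2) = liftGens (halvingGens 3 ϱ) 1) ∧
          -- … with `2^{p-2}·p` edges (type 0), `2^{p-1}` vertices (type 1)
          -- and `2^{p-1}` faces (type 2)
          Nat.card {x : (halvingCosetSystem 3 ϱ).X //
            (halvingCosetSystem 3 ϱ).t x = 0} = 2 ^ (p - 2) * p ∧
          Nat.card {x : (halvingCosetSystem 3 ϱ).X //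
            (halvingCosetSystem 3 ϱ).t x = 1} = 2 ^ (p - 1) ∧
          Nat.card {x : (halvingCosetSystem 3 ϱ).X //
            (halvingCosetSystem 3 ϱ).t x = 2} = 2 ^ (p - 1) ∧
          -- Euler characteristic and genus
          (2 ^ (p - 1) : ℤ) - 2 ^ (p - 2) * (p : ℤ) + 2 ^ (p - 1) =
            2 ^ (p - 2) * (4 - (p : ℤ)) ∧
          (2 ^ (p - 2) * (4 - (p : ℤ)) =
            2 - 2 * (2 ^ (p - 3) * ((p : ℤ) - 4) + 1)) := by
  obtain ⟨F₀, hF₀, -⟩ := exists_isMaxFlag_mem (P := Kᵒᵈ) (OrderDual.toDual hK.1.choose)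
  obtain ⟨c, -⟩ := CyclicLabelling.exists_of_isPolytope hK hp hvert hF₀
  have hC := genCube.isPolytope c.isPolytope c.vertexDescribable
  refine ⟨⟨_, hC⟩, fun rkC hrkC => ?_⟩
  obtain rfl : rkC = genCube.rank := hrkC.rk_unique hC
  refine ⟨hC.orderDual, c.nonDegenerate, hC.orderDual.isRegular_of_distinguishedGens fun Φ hΦ =>
    (exists_isDistinguishedGens_D2 hK hp hvert hΦ).imp fun _ h => h.1, fun ΦD ϱ hϱ => ?_⟩
  have h : IsHalvableGens ϱ p := by
    obtain ⟨ϱ', hϱ', h'⟩ := exists_isDistinguishedGens_D2 hK hp hvert hϱ.1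
    rwa [hC.orderDual.distinguishedGens_unique hϱ hϱ']
  refine ⟨h.orderOf_zero_one, h.orderOf_one_two, h.isHalvedGens.isRegularHypertope,
    h.orderOf_zero_one, h.orderOf_halving_zero_two, h.orderOf_halving_one_two, h.exists_mulAut,
    h.isHalvedGens.card_zero, h.isHalvedGens.card_one, h.isHalvedGens.card_two, ?_, ?_⟩
  · obtain ⟨q, rfl⟩ := Nat.exists_eq_add_of_le hp
    rw [show 3 + q - 1 = q + 2 by omega, show 3 + q - 2 = q + 1 by omega]
    push_cast
    ring
  · obtain ⟨q, rfl⟩ := Nat.exists_eq_add_of_le hp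
    rw [show 3 + q - 2 = q + 1 by omega, show 3 + q - 3 = q by omega]
    push_cast
    ring
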